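/- arXiv:1902.03333 — 2 statements merged into one kernel-verified Lean document; each statement's English description precedes it below -/
import Mathlib

section
/- The relation ≤ (existence of a local map) defines a total order on the set KL of local equivalence classes of knot-like complexes: it is reflexive, transitive, antisymmetric on local equivalence classes, and for any two knot-like complexes C_1 and C_2, either C_1 ≤ C_2 or C_2 ≤ C_1. -/
/-!
Common setup: the ring `R = 𝔽₂[U,V]/(UV = 0)`, bigraded free finitely generated chain
complexes over `R` ("pre-complexes"), knot-like complexes, local maps and local
equivalence, standard and semistandard complexes, short maps, the `Z^!` order,
the invariants `a_i`, `φ_j`, `P`, shift maps, tensor products, duals, and direct sums.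
-/

set_option synthInstance.maxHeartbeats 1000000
set_option maxHeartbeats 1000000

noncomputable section

/-- The polynomial ring `𝔽₂[U,V]`. -/
abbrev PolyUV : Type := MvPolynomial (Fin 2) (ZMod 2)

/-- The ideal `(U·V)`. -/
def IUV : Ideal PolyUV := Ideal.span {(MvPolynomial.X 0 * MvPolynomial.X 1 : PolyUV)}

/-- The ring `R = 𝔽₂[U,V]/(UV = 0)`. -/
abbrev RUV : Type := PolyUV ⧸ IUV

instance : CommRing RUV := Ideal.Quotient.commRing IUV

/-- The image of `U` in `R`. -/
def Uv : RUV := Ideal.Quotient.mk IUV (MvPolynomial.X 0)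

/-- The image of `V` in `R`. -/
def Vv : RUV := Ideal.Quotient.mk IUV (MvPolynomial.X 1)

/-- `r ∈ R` is homogeneous of bidegree `(p, q)` for the bigrading with
`gr(U) = (-2, 0)`, `gr(V) = (0, -2)`, `gr(1) = (0, 0)` (coefficients in `𝔽₂`). -/
def IsHomog (r : RUV) (p q : ℤ) : Prop :=
  r = 0 ∨ (∃ a : ℕ, r = Uv ^ a ∧ p = -(2 * (a : ℤ)) ∧ q = 0) ∨
    (∃ b : ℕ, r = Vv ^ b ∧ p = 0 ∧ q = -(2 * (b : ℤ)))

/-- A finitely generated free bigraded module over `R` with a distinguished basis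
indexed by `Fin n`, together with a bigrading `gr` on the basis and a matrix `dm`
recording a prospective differential: `dm i j` is the coefficient of the `j`-th basis
vector in the differential of the `i`-th basis vector. -/
structure PreCx where
  n : ℕ
  gr : Fin n → ℤ × ℤ
  dm : Fin n → Fin n → RUV

/-- The underlying free `R`-module of a pre-complex. -/
abbrev Msub (C : PreCx) : Type := Fin C.n →₀ RUV

/-- The differential of a pre-complex, as an `R`-linear map. -/
def dmap (C : PreCx) : Msub C →ₗ[RUV] Msub C :=
  Finsupp.linearCombination RUV fun i => ∑ j, Finsupp.single j (C.dm i j)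

/-- The submodule `U·C ⊆ C`; `C/U` is the quotient by this submodule. -/
def uSub (C : PreCx) : Submodule RUV (Msub C) :=
  LinearMap.range (LinearMap.lsmul RUV (Msub C) Uv)

/-- The submodule `V·C ⊆ C`; `C/V` is the quotient by this submodule. -/
def vSub (C : PreCx) : Submodule RUV (Msub C) :=
  LinearMap.range (LinearMap.lsmul RUV (Msub C) Vv)

/-- Chains which die in the homology of `C/U`: the preimage in `C` of the boundaries of
the induced differential on `C/U`. -/
def bdryU (C : PreCx) : Submodule RUV (Msub C) := uSub C ⊔ LinearMap.range (dmap C)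

/-- Chains which die in the homology of `C/V`. -/
def bdryV (C : PreCx) : Submodule RUV (Msub C) := vSub C ⊔ LinearMap.range (dmap C)

/-- A chain `x ∈ C` is homogeneous of bidegree `(p, q)`. -/
def ChainHomog (C : PreCx) (x : Msub C) (p q : ℤ) : Prop :=
  ∀ j, IsHomog (x j) (p - (C.gr j).1) (q - (C.gr j).2)

/-- `x` is a `V`-tower class generator: its class in `H_*(C/U)` is a `V`-nontorsion cycle
whose image generates `H_*(C/U)/(V-torsion)` (equivalently, it is maximally `V`-graded
among `V`-nontorsion classes). -/
def IsVTowerGen (C : PreCx) (x : Msub C) : Prop :=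
  dmap C x ∈ uSub C ∧ (∀ k : ℕ, Vv ^ k • x ∉ bdryU C) ∧
    ∀ z : Msub C, dmap C z ∈ uSub C →
      ∃ (r : RUV) (k : ℕ), Vv ^ k • (z - r • x) ∈ bdryU C

/-- `x` is a `U`-tower class generator: its class in `H_*(C/V)` is a `U`-nontorsion cycle
whose image generates `H_*(C/V)/(U-torsion)`. -/
def IsUTowerGen (C : PreCx) (x : Msub C) : Prop :=
  dmap C x ∈ vSub C ∧ (∀ k : ℕ, Uv ^ k • x ∉ bdryV C) ∧
    ∀ z : Msub C, dmap C z ∈ vSub C →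
      ∃ (r : RUV) (k : ℕ), Uv ^ k • (z - r • x) ∈ bdryV C

/-- `C` is a chain complex over `R` whose differential has degree `(-1, -1)`. -/
def IsCplx (C : PreCx) : Prop :=
  (∀ x, dmap C (dmap C x) = 0) ∧
    ∀ i j, IsHomog (C.dm i j) ((C.gr i).1 - 1 - (C.gr j).1) ((C.gr i).2 - 1 - (C.gr j).2)

/-- A knot-like complex: a free, finitely generated, bigraded chain complex over `R`
whose differential has degree `(-1,-1)`, such that `H_*(C/U)/(V`-torsion`) ≅ 𝔽₂[V]` with
all `V`-nontorsion elements of `H_*(C/U)` in `U`-grading `0`, and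
`H_*(C/V)/(U`-torsion`) ≅ 𝔽₂[U]` with all `U`-nontorsion elements of `H_*(C/V)` in
`V`-grading `0`. -/
structure IsKnotLike (C : PreCx) : Prop where
  dsq : ∀ x, dmap C (dmap C x) = 0
  dhomog : ∀ i j, IsHomog (C.dm i j)
    ((C.gr i).1 - 1 - (C.gr j).1) ((C.gr i).2 - 1 - (C.gr j).2)
  vTowerExists : ∃ x, IsVTowerGen C x
  vTowerGr : ∀ x p q, ChainHomog C x p q → dmap C x ∈ uSub C →
    (∀ k : ℕ, Vv ^ k • x ∉ bdryU C) → p = 0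
  uTowerExists : ∃ x, IsUTowerGen C x
  uTowerGr : ∀ x p q, ChainHomog C x p q → dmap C x ∈ vSub C →
    (∀ k : ℕ, Uv ^ k • x ∉ bdryV C) → q = 0

/-- A module map `f : C₁ → C₂` is homogeneous of bidegree `(s, t)`. -/
def MapHomogShift (C₁ C₂ : PreCx) (f : Msub C₁ →ₗ[RUV] Msub C₂) (s t : ℤ) : Prop :=
  ∀ i j, IsHomog (f (Finsupp.single i 1) j)
    ((C₁.gr i).1 + s - (C₂.gr j).1) ((C₁.gr i).2 + t - (C₂.gr j).2)

/-- A local map `f : C₁ → C₂`: an absolutely `U`-graded, relatively `V`-graded,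
`R`-equivariant chain map inducing an isomorphism on `H_*(·/U)/(V-torsion)`
(equivalently, taking `V`-tower generators to `V`-tower generators). -/
structure IsLocalMap (C₁ C₂ : PreCx) (f : Msub C₁ →ₗ[RUV] Msub C₂) : Prop where
  chain : ∀ x, f (dmap C₁ x) = dmap C₂ (f x)
  graded : ∃ s : ℤ, MapHomogShift C₁ C₂ f 0 s
  towers : ∀ x, IsVTowerGen C₁ x → IsVTowerGen C₂ (f x)

/-- `C₁ ≤ C₂`: there exists a local map `C₁ → C₂`. -/
def LocalLE (C₁ C₂ : PreCx) : Prop := ∃ f, IsLocalMap C₁ C₂ f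

/-- Local equivalence of complexes: local maps in both directions. -/
def LocalEquiv (C₁ C₂ : PreCx) : Prop := LocalLE C₁ C₂ ∧ LocalLE C₂ C₁

/-- `C` is reduced: `∂ ≡ 0 mod (U, V)`. -/
def Reduced (C : PreCx) : Prop := ∀ i j, C.dm i j ∈ Ideal.span ({Uv, Vv} : Set RUV)

/-! ### Standard complexes -/

/-- The shift in bigrading from `x_k` to `x_{k+1}` in a standard complex, where the
parameter joining them is `b` (`k` is the 0-based index of the parameter, so the
parameter is a `U`-power arrow if `k` is even and a `V`-power arrow if `k` is odd). -/
def stepShift (k : ℕ) (b : ℤ) : ℤ × ℤ :=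
  if k % 2 = 0 then
    if b < 0 then (2 * (b.natAbs : ℤ) - 1, -1) else (1 - 2 * (b.natAbs : ℤ), 1)
  else
    if b < 0 then (-1, 2 * (b.natAbs : ℤ) - 1) else (1, 1 - 2 * (b.natAbs : ℤ))

/-- Bigrading of `x_i` relative to `x_0` in the standard complex with parameters `L`. -/
def grRel (L : List ℤ) (i : ℕ) : ℤ × ℤ :=
  ∑ k ∈ Finset.range i, stepShift k (L.getD k 0)

/-- The bigrading of the standard complex of parameters `L`, normalized so that
`gr_U(x_0) = 0` and `gr_V(x_n) = 0`. -/
def stdGr (L : List ℤ) (i : Fin (L.length + 1)) : ℤ × ℤ :=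
  ((grRel L (i : ℕ)).1, (grRel L (i : ℕ)).2 - (grRel L L.length).2)

/-- The differential matrix of the standard complex of parameters `L = (b_1, …, b_n)`:
for `i` odd (1-based), `∂_U x_{i-1} = U^{|b_i|} x_i` if `b_i < 0` and
`∂_U x_i = U^{b_i} x_{i-1}` if `b_i > 0`; for `i` even the same with `V` in place of `U`;
all other differentials vanish. -/
def stdDm (L : List ℤ) (i j : Fin (L.length + 1)) : RUV :=
  if (j : ℕ) = (i : ℕ) + 1 ∧ L.getD (i : ℕ) 0 < 0 then
    (if (i : ℕ) % 2 = 0 then Uv else Vv) ^ (L.getD (i : ℕ) 0).natAbs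
  else if (i : ℕ) = (j : ℕ) + 1 ∧ 0 < L.getD (j : ℕ) 0 then
    (if (j : ℕ) % 2 = 0 then Uv else Vv) ^ (L.getD (j : ℕ) 0).natAbs
  else 0

/-- The standard complex `C(b_1, …, b_n)` of a list of parameters `L = (b_1, …, b_n)`,
with generators `x_0, …, x_n`.  (For `L = []` this is the trivial complex `R`.) -/
def StdCx (L : List ℤ) : PreCx := ⟨L.length + 1, stdGr L, stdDm L⟩

/-- `L` is a valid parameter sequence for a standard complex: all entries are nonzero
and the length is even (possibly zero). -/
def IsStdSeq (L : List ℤ) : Prop := (∀ b ∈ L, b ≠ 0) ∧ Even L.length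

/-- The trivial standard complex `C(0) = R`. -/
def trivCx : PreCx := StdCx []

/-- The bigrading of the semistandard complex `C'(b_1, …, b_n)` (`n` odd), inherited from
the ambient standard complex `C(b_1, …, b_n, 1)`. -/
def semiGr (L : List ℤ) (i : Fin (L.length + 1)) : ℤ × ℤ :=
  ((grRel L (i : ℕ)).1, (grRel L (i : ℕ)).2 - (grRel L L.length).2 + 1)

/-- The semistandard complex `C'(b_1, …, b_n)` (`n` odd): the subcomplex of
`C(b_1, …, b_n, 1)` generated by `x_0, …, x_n`. -/
def SemiStdCx (L : List ℤ) : PreCx := ⟨L.length + 1, semiGr L, stdDm L⟩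

/-! ### Tensor products, duals, direct sums -/

/-- The tensor product (over `R`) of two pre-complexes, with basis `x_i ⊗ y_j` and
differential `∂(x ⊗ y) = ∂x ⊗ y + x ⊗ ∂y` (signs are irrelevant in characteristic 2). -/
def tensorCx (C₁ C₂ : PreCx) : PreCx where
  n := C₁.n * C₂.n
  gr := fun p => C₁.gr (finProdFinEquiv.symm p).1 + C₂.gr (finProdFinEquiv.symm p).2
  dm := fun p q =>
    (if (finProdFinEquiv.symm p).2 = (finProdFinEquiv.symm q).2 then
      C₁.dm (finProdFinEquiv.symm p).1 (finProdFinEquiv.symm q).1 else 0) +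
    (if (finProdFinEquiv.symm p).1 = (finProdFinEquiv.symm q).1 then
      C₂.dm (finProdFinEquiv.symm p).2 (finProdFinEquiv.symm q).2 else 0)

/-- The dual complex `C^∨ = Hom_R(C, R)`, described on the dual basis: the gradings are
negated and the differential matrix is transposed. -/
def dualCx (C : PreCx) : PreCx := ⟨C.n, fun i => -C.gr i, fun i j => C.dm j i⟩

/-- The direct sum of two pre-complexes. -/
def sumCx (C₁ C₂ : PreCx) : PreCx where
  n := C₁.n + C₂.n
  gr := fun p => Sum.elim C₁.gr C₂.gr (finSumFinEquiv.symm p)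
  dm := fun p q =>
    match finSumFinEquiv.symm p, finSumFinEquiv.symm q with
    | Sum.inl i, Sum.inl k => C₁.dm i k
    | Sum.inr j, Sum.inr l => C₂.dm j l
    | _, _ => 0

/-- A homotopy equivalence of bigraded chain complexes over `R`: chain maps `f, g`
preserving the bigrading, with `g ∘ f ≃ id` and `f ∘ g ≃ id` via `R`-equivariant
homotopies of bidegree `(1, 1)`. -/
def HomotopyEquivCx (C₁ C₂ : PreCx) : Prop :=
  ∃ (f : Msub C₁ →ₗ[RUV] Msub C₂) (g : Msub C₂ →ₗ[RUV] Msub C₁)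
    (H : Msub C₁ →ₗ[RUV] Msub C₁) (K : Msub C₂ →ₗ[RUV] Msub C₂),
    (∀ x, f (dmap C₁ x) = dmap C₂ (f x)) ∧
    (∀ y, g (dmap C₂ y) = dmap C₁ (g y)) ∧
    MapHomogShift C₁ C₂ f 0 0 ∧ MapHomogShift C₂ C₁ g 0 0 ∧
    MapHomogShift C₁ C₁ H 1 1 ∧ MapHomogShift C₂ C₂ K 1 1 ∧
    (∀ x, g (f x) - x = dmap C₁ (H x) + H (dmap C₁ x)) ∧
    (∀ y, f (g y) - y = dmap C₂ (K y) + K (dmap C₂ y))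

/-- An isomorphism of bigraded chain complexes over `R`. -/
def IsBigradedChainIso (C₁ C₂ : PreCx) (f : Msub C₁ →ₗ[RUV] Msub C₂) : Prop :=
  Function.Bijective f ∧ (∀ x, f (dmap C₁ x) = dmap C₂ (f x)) ∧ MapHomogShift C₁ C₂ f 0 0

/-! ### Short maps -/

/-- A short map `f : C(b_1, …, b_n) ⇝ C`: an absolutely `U`-graded, relatively
`V`-graded `R`-module map which is a chain map at `x_1, …, x_{n-1}` and commutes with
the `V`-part of the differential at `x_n` (for reduced `C`, the failure
`∂ f(x_n) - f(∂_V x_n)` is exactly `∂_U f(x_n) ∈ U·C`). -/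
def IsShortMap (L : List ℤ) (C : PreCx) (f : Msub (StdCx L) →ₗ[RUV] Msub C) : Prop :=
  (∃ s : ℤ, MapHomogShift (StdCx L) C f 0 s) ∧
  (∀ i : Fin (L.length + 1), 1 ≤ (i : ℕ) → (i : ℕ) + 1 ≤ L.length →
    f (dmap (StdCx L) (Finsupp.single i 1)) = dmap C (f (Finsupp.single i 1))) ∧
  dmap C (f (Finsupp.single (Fin.last L.length) 1)) -
    f (dmap (StdCx L) (Finsupp.single (Fin.last L.length) 1)) ∈ uSub C

/-- A short local map: a short map sending the `V`-tower generator `x_0` to a `V`-tower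
generator (hence inducing an isomorphism on `H_*(·/U)/(V-torsion)`). -/
def IsShortLocalMap (L : List ℤ) (C : PreCx) (f : Msub (StdCx L) →ₗ[RUV] Msub C) : Prop :=
  IsShortMap L C f ∧ IsVTowerGen C (f (Finsupp.single (0 : Fin (L.length + 1)) 1))

/-- A local map from the semistandard complex `C'(b_1, …, b_n)` to a knot-like complex:
a grading-preserving `R`-equivariant chain map under which the class of `x_0`
generates `H_*(C/U)/(V-torsion)`. -/
def IsSemiLocalMap (L : List ℤ) (C : PreCx) (f : Msub (SemiStdCx L) →ₗ[RUV] Msub C) : Prop :=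
  (∀ x, f (dmap (SemiStdCx L) x) = dmap C (f x)) ∧
  MapHomogShift (SemiStdCx L) C f 0 0 ∧
  IsVTowerGen C (f (Finsupp.single (0 : Fin (L.length + 1)) 1))

/-! ### The order `Z^!` and the numerical invariants -/

/-- The embedding of `Z^!` into `ℚ` realizing the order
`-1 <^! -2 <^! ⋯ <^! 0 <^! ⋯ <^! 2 <^! 1`: send `0 ↦ 0` and `a ↦ 1/a` otherwise. -/
def qval (a : ℤ) : ℚ := if a = 0 then 0 else 1 / (a : ℚ)

/-- The order `≤^!` on `Z^!`. -/
def bangLE (a b : ℤ) : Prop := qval a ≤ qval b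

/-- Pad a finite sequence with trailing zeros. -/
def seqPad (L : List ℤ) (i : ℕ) : ℤ := L.getD i 0

/-- The lexicographic order on finite integer sequences induced by `≤^!`, padding the
shorter sequence with trailing zeros. -/
def bangLexLE (L₁ L₂ : List ℤ) : Prop :=
  (∀ i, seqPad L₁ i = seqPad L₂ i) ∨
    ∃ k, (∀ i < k, seqPad L₁ i = seqPad L₂ i) ∧ qval (seqPad L₁ k) < qval (seqPad L₂ k)

/-- `m` is an upper bound for `S ⊆ Z^!` with respect to `≤^!`. -/
def IsBangUB (S : Set ℤ) (m : ℤ) : Prop := ∀ b ∈ S, qval b ≤ qval m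

/-- `m = sup^! S`, the least upper bound of `S ⊆ Z^!` with respect to `≤^!`. -/
def IsBangLUB (S : Set ℤ) (m : ℤ) : Prop :=
  IsBangUB S m ∧ ∀ m' : ℤ, IsBangUB S m' → qval m ≤ qval m'

/-- Candidate set for the next invariant: given the already-constructed prefix `P`,
those nonzero `b` such that some standard complex `C(P, b, rest) ≤ C`. -/
def candSet (C : PreCx) (P : List ℤ) : Set ℤ :=
  {b | b ≠ 0 ∧ ∃ rest : List ℤ, IsStdSeq (P ++ b :: rest) ∧ LocalLE (StdCx (P ++ b :: rest)) C}

/-- `a` is the sequence of numerical invariants `a_i(C)` (indexed from `0`):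
once a term vanishes all later terms vanish, and otherwise each term is
`sup^!` of the corresponding candidate set. -/
def InvSeq (C : PreCx) (a : ℕ → ℤ) : Prop :=
  ∀ k : ℕ,
    ((∃ i < k, a i = 0) → a k = 0) ∧
    ((∀ i < k, a i ≠ 0) → IsBangLUB (candSet C ((List.range k).map a)) (a k))

/-- The first `n` terms of `a`, with the (all-zero) tail deleted. -/
def truncSeq (a : ℕ → ℤ) (n : ℕ) : List ℤ :=
  ((List.range n).map a).takeWhile (fun b => b != 0)

/-! ### The homomorphisms `φ_j`, `P` and the shifts `sh_m` -/

/-- `φ_j` of a standard complex `C(a_1, …, a_n)`: the signed count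
`#{i odd : a_i = j} − #{i odd : a_i = −j}` (with 1-based odd `i`). -/
def phi (j : ℕ) (L : List ℤ) : ℤ :=
  ∑ i ∈ Finset.range L.length,
    if i % 2 = 0 then
      (if L.getD i 0 = (j : ℤ) then 1 else 0) - (if L.getD i 0 = -(j : ℤ) then 1 else 0)
    else 0

/-- The shift `sh_m` on parameter sequences: entries of absolute value `≥ m` are pushed
one further from zero; entries of absolute value `< m` are fixed. -/
def shSeq (m : ℕ) (L : List ℤ) : List ℤ :=
  L.map fun a => if (m : ℤ) ≤ a then a + 1 else if a ≤ -(m : ℤ) then a - 1 else a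

/-- `P(C) = -2 ∑_{j>0} j φ_j(C) + ∑_i sgn a_i`, computed from the parameter sequence of
the standard representative (the sum over `j` is finite since `φ_j` vanishes for
`j` larger than any `|a_i|`). -/
def Pval (L : List ℤ) : ℤ :=
  -2 * (∑ j ∈ Finset.range ((L.map Int.natAbs).sum + 1), (j : ℤ) * phi j L) +
    (L.map Int.sign).sum

end

/-! ### The ring `R` -/

theorem Uv_mul_Vv : Uv * Vv = 0 := by
  rw [Uv, Vv, ← map_mul]
  exact Ideal.Quotient.eq_zero_iff_mem.2 (Ideal.subset_span rfl)

namespace RUV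

/-- The ring homomorphism out of `R` sending `U` to `a` and `V` to `b`, where `ab = 0`. -/
noncomputable def lift {S : Type*} [CommRing S] [Algebra (ZMod 2) S] (a b : S) (h : a * b = 0) :
    RUV →+* S :=
  Ideal.Quotient.lift IUV (MvPolynomial.eval₂Hom (algebraMap (ZMod 2) S) ![a, b]) fun r hr => by
    have : IUV ≤ RingHom.ker (MvPolynomial.eval₂Hom (algebraMap (ZMod 2) S) ![a, b]) := by
      rw [IUV, Ideal.span_le]
      simp [RingHom.mem_ker, h]
    exact this hr

section lift
variable {S : Type*} [CommRing S] [Algebra (ZMod 2) S] {a b : S} (h : a * b = 0)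

@[simp] theorem lift_Uv : lift a b h Uv = a :=
  (Ideal.Quotient.lift_mk _ _ _).trans (by simp)

@[simp] theorem lift_Vv : lift a b h Vv = b :=
  (Ideal.Quotient.lift_mk _ _ _).trans (by simp)

end lift

theorem ringHom_ext {S : Type*} [Semiring S] {f g : RUV →+* S}
    (hU : f Uv = g Uv) (hV : f Vv = g Vv) : f = g := by
  apply Ideal.Quotient.ringHom_ext
  apply MvPolynomial.ringHom_ext
  · intro r
    exact DFunLike.congr_fun (Subsingleton.elim
      ((f.comp (Ideal.Quotient.mk IUV)).comp MvPolynomial.C)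
      ((g.comp (Ideal.Quotient.mk IUV)).comp MvPolynomial.C)) r
  · intro i
    fin_cases i
    · exact hU
    · exact hV

theorem add_self (r : RUV) : r + r = 0 := by
  have h : (2 : RUV) = 0 := by
    have := congrArg (algebraMap (ZMod 2) RUV) (show (2 : ZMod 2) = 0 from rfl)
    rwa [map_zero, map_ofNat] at this
  rw [← two_mul, h, zero_mul]

open Polynomial

/-- The quotient map `R → R/V ≅ 𝔽₂[U]`. -/
noncomputable def toPolyU : RUV →+* (ZMod 2)[X] := lift X 0 (mul_zero _)

/-- The quotient map `R → R/U ≅ 𝔽₂[V]`. -/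
noncomputable def toPolyV : RUV →+* (ZMod 2)[X] := lift 0 X (zero_mul _)

/-- The inclusion `𝔽₂[U] → R`. -/
noncomputable def ofPolyU : (ZMod 2)[X] →+* RUV := (aeval Uv).toRingHom

/-- The inclusion `𝔽₂[V] → R`. -/
noncomputable def ofPolyV : (ZMod 2)[X] →+* RUV := (aeval Vv).toRingHom

@[simp] theorem toPolyU_Uv : toPolyU Uv = X := lift_Uv _
@[simp] theorem toPolyU_Vv : toPolyU Vv = 0 := lift_Vv _
@[simp] theorem toPolyV_Uv : toPolyV Uv = 0 := lift_Uv _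
@[simp] theorem toPolyV_Vv : toPolyV Vv = X := lift_Vv _
@[simp] theorem ofPolyU_X : ofPolyU X = Uv := aeval_X _
@[simp] theorem ofPolyV_X : ofPolyV X = Vv := aeval_X _

theorem polyHom_ext {S : Type*} [Semiring S] {f g : (ZMod 2)[X] →+* S} (h : f X = g X) :
    f = g :=
  Polynomial.ringHom_ext' (Subsingleton.elim _ _) h

@[simp] theorem toPolyU_ofPolyU (a : (ZMod 2)[X]) : toPolyU (ofPolyU a) = a :=
  DFunLike.congr_fun (f := toPolyU.comp ofPolyU) (g := RingHom.id _) (polyHom_ext (by simp)) a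

@[simp] theorem toPolyV_ofPolyV (a : (ZMod 2)[X]) : toPolyV (ofPolyV a) = a :=
  DFunLike.congr_fun (f := toPolyV.comp ofPolyV) (g := RingHom.id _) (polyHom_ext (by simp)) a

@[simp] theorem toPolyU_ofPolyV (a : (ZMod 2)[X]) : toPolyU (ofPolyV a) = C (a.coeff 0) :=
  DFunLike.congr_fun (f := toPolyU.comp ofPolyV) (g := C.comp constantCoeff)
    (polyHom_ext (by simp)) a

@[simp] theorem toPolyV_ofPolyU (a : (ZMod 2)[X]) : toPolyV (ofPolyU a) = C (a.coeff 0) :=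
  DFunLike.congr_fun (f := toPolyV.comp ofPolyU) (g := C.comp constantCoeff)
    (polyHom_ext (by simp)) a

theorem coeff_zero_toPoly (r : RUV) : (toPolyU r).coeff 0 = (toPolyV r).coeff 0 :=
  DFunLike.congr_fun (f := (constantCoeff (R := ZMod 2)).comp toPolyU)
    (g := constantCoeff.comp toPolyV)
    (ringHom_ext (by simp) (by simp)) r

theorem Uv_dvd_sub (r : RUV) : Uv ∣ r - ofPolyV (toPolyV r) := by
  rw [← Ideal.mem_span_singleton, ← Ideal.Quotient.mk_eq_mk_iff_sub_mem]
  refine DFunLike.congr_fun (f := Ideal.Quotient.mk (Ideal.span {Uv}))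
    (g := (Ideal.Quotient.mk _).comp (ofPolyV.comp toPolyV)) (ringHom_ext ?_ (by simp)) r
  simp

theorem Vv_dvd_sub (r : RUV) : Vv ∣ r - ofPolyU (toPolyU r) := by
  rw [← Ideal.mem_span_singleton, ← Ideal.Quotient.mk_eq_mk_iff_sub_mem]
  refine DFunLike.congr_fun (f := Ideal.Quotient.mk (Ideal.span {Vv}))
    (g := (Ideal.Quotient.mk _).comp (ofPolyU.comp toPolyU)) (ringHom_ext (by simp) ?_) r
  simp

theorem toPolyV_eq_zero_iff {r : RUV} : toPolyV r = 0 ↔ Uv ∣ r := by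
  refine ⟨fun h => by simpa [h] using Uv_dvd_sub r, ?_⟩
  rintro ⟨s, rfl⟩
  simp

theorem eq_zero_of_toPoly {r : RUV} (hU : toPolyU r = 0) (hV : toPolyV r = 0) : r = 0 := by
  obtain ⟨s, rfl⟩ := toPolyV_eq_zero_iff.1 hV
  have hs : toPolyU s = 0 := by simpa using hU
  obtain ⟨t, ht⟩ := Vv_dvd_sub s
  rw [hs, map_zero, sub_zero] at ht
  rw [ht, ← mul_assoc, Uv_mul_Vv, zero_mul]

theorem exists_toPoly {a b : (ZMod 2)[X]} (h : a.coeff 0 = b.coeff 0) :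
    ∃ r, toPolyU r = a ∧ toPolyV r = b := by
  have key : ∀ c : ZMod 2, toPolyU (ofPolyU (C c)) = C c ∧ toPolyV (ofPolyU (C c)) = C c :=
    fun c => by simp
  refine ⟨ofPolyU a + ofPolyV b - ofPolyU (C (a.coeff 0)), ?_, ?_⟩
  · simp [h]
  · simp

theorem add_induction {P : RUV → Prop} (hU : ∀ n, P (Uv ^ n)) (hV : ∀ n, P (Vv ^ n))
    (zero : P 0) (add : ∀ r s, P r → P s → P (r + s)) (r : RUV) : P r := by
  have aux : ∀ f : (ZMod 2)[X] →+* RUV, (∀ n, P (f X ^ n)) → ∀ a, P (f a) := by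
    intro f hf a
    induction a using Polynomial.induction_on' with
    | add p q hp hq => rw [map_add]; exact add _ _ hp hq
    | monomial n c =>
      rcases (by decide : ∀ c : ZMod 2, c = 0 ∨ c = 1) c with rfl | rfl
      · simpa using zero
      · simpa [monomial_one_right_eq_X_pow] using hf n
  have hr : r = ofPolyU (toPolyU r) + ofPolyV (toPolyV r + C ((toPolyV r).coeff 0)) := by
    rw [← sub_eq_zero]
    apply eq_zero_of_toPoly
    · simp [CharTwo.add_self_eq_zero]
    · simp only [map_sub, map_add, toPolyV_ofPolyU, toPolyV_ofPolyV, coeff_zero_toPoly]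
      rw [add_left_comm, CharTwo.add_self_eq_zero, add_zero, sub_self]
  rw [hr]
  exact add _ _ (aux _ (by simpa using hU) _) (aux _ (by simpa using hV) _)

/-! ### Homogeneous components -/

/-- The coaction `R → R[ℤ × ℤ]` that records the bigrading of `R`. -/
noncomputable def grading : RUV →+* AddMonoidAlgebra RUV (ℤ × ℤ) :=
  lift (.single (-2, 0) Uv) (.single (0, -2) Vv)
    (by rw [AddMonoidAlgebra.single_mul_single, Uv_mul_Vv, AddMonoidAlgebra.single_zero])

/-- The homogeneous component of bidegree `d`. -/
noncomputable def comp (d : ℤ × ℤ) : RUV →+ RUV where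
  toFun r := (grading r).coeff d
  map_zero' := by simp
  map_add' r s := by simp

end RUV

theorem IsHomog.zero (p q : ℤ) : IsHomog 0 p q := .inl rfl

theorem IsHomog.add {r s : RUV} {p q : ℤ} (hr : IsHomog r p q) (hs : IsHomog s p q) :
    IsHomog (r + s) p q := by
  rcases hr with rfl | hr
  · rwa [zero_add]
  rcases hs with rfl | hs
  · rw [add_zero]; exact .inr hr
  obtain rfl : r = s := by
    rcases hr with ⟨a, rfl, h1, h2⟩ | ⟨a, rfl, h1, h2⟩ <;>
    rcases hs with ⟨b, rfl, h3, h4⟩ | ⟨b, rfl, h3, h4⟩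
    · rw [show a = b by omega]
    · rw [show a = 0 by omega, show b = 0 by omega, pow_zero, pow_zero]
    · rw [show a = 0 by omega, show b = 0 by omega, pow_zero, pow_zero]
    · rw [show a = b by omega]
  exact .inl (RUV.add_self r)

theorem IsHomog.sum {ι : Type*} {s : Finset ι} {f : ι → RUV} {p q : ℤ}
    (h : ∀ i ∈ s, IsHomog (f i) p q) : IsHomog (∑ i ∈ s, f i) p q :=
  Finset.sum_induction f (IsHomog · p q) (fun _ _ => IsHomog.add) (.zero p q) h

namespace RUV

theorem grading_Uv_pow (n : ℕ) : grading (Uv ^ n) = .single (-(2 * n), 0) (Uv ^ n) := by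
  rw [map_pow, grading, lift_Uv, AddMonoidAlgebra.single_pow]
  congr 1
  ext <;> simp [mul_comm]

theorem grading_Vv_pow (n : ℕ) : grading (Vv ^ n) = .single (0, -(2 * n)) (Vv ^ n) := by
  rw [map_pow, grading, lift_Vv, AddMonoidAlgebra.single_pow]
  congr 1
  ext <;> simp [mul_comm]

theorem comp_Uv_pow (d : ℤ × ℤ) (n : ℕ) :
    comp d (Uv ^ n) = if d = (-(2 * n : ℤ), 0) then Uv ^ n else 0 := by
  simp only [comp, AddMonoidHom.coe_mk, ZeroHom.coe_mk, grading_Uv_pow,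
    AddMonoidAlgebra.coeff_single, Finsupp.single_apply, eq_comm]

theorem comp_Vv_pow (d : ℤ × ℤ) (n : ℕ) :
    comp d (Vv ^ n) = if d = (0, -(2 * n : ℤ)) then Vv ^ n else 0 := by
  simp only [comp, AddMonoidHom.coe_mk, ZeroHom.coe_mk, grading_Vv_pow,
    AddMonoidAlgebra.coeff_single, Finsupp.single_apply, eq_comm]

theorem isHomog_comp (d : ℤ × ℤ) (r : RUV) : IsHomog (comp d r) d.1 d.2 := by
  refine add_induction (P := fun r => IsHomog (comp d r) d.1 d.2) (fun n => ?_) (fun n => ?_) ?_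
    (fun r s hr hs => ?_) r
  · rw [comp_Uv_pow]
    split_ifs with h
    · exact .inr (.inl ⟨n, rfl, by simp [h]⟩)
    · exact .zero _ _
  · rw [comp_Vv_pow]
    split_ifs with h
    · exact .inr (.inr ⟨n, rfl, by simp [h]⟩)
    · exact .zero _ _
  · rw [map_zero]; exact .zero _ _
  · rw [map_add]; exact hr.add hs

theorem grading_of_isHomog {r : RUV} {d : ℤ × ℤ} (h : IsHomog r d.1 d.2) :
    grading r = .single d r := by
  obtain ⟨p, q⟩ := d
  obtain rfl | ⟨a, rfl, rfl, rfl⟩ | ⟨a, rfl, rfl, rfl⟩ := h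
  · simp
  · exact grading_Uv_pow a
  · exact grading_Vv_pow a

theorem comp_mul_of_isHomog {s : RUV} {e : ℤ × ℤ} (hs : IsHomog s e.1 e.2) (d : ℤ × ℤ) (r : RUV) :
    comp d (r * s) = comp (d - e) r * s := by
  simp only [comp, AddMonoidHom.coe_mk, ZeroHom.coe_mk, map_mul, grading_of_isHomog hs]
  rw [AddMonoidAlgebra.coeff_mul_single_apply, sub_eq_add_neg]

theorem comp_mul_of_isHomog_left {s : RUV} {e : ℤ × ℤ} (hs : IsHomog s e.1 e.2) (d : ℤ × ℤ)
    (r : RUV) : comp d (s * r) = s * comp (d - e) r := by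
  rw [mul_comm, comp_mul_of_isHomog hs, mul_comm]

theorem isHomog_Uv : IsHomog Uv (-2, 0).1 (-2, 0).2 :=
  .inr (.inl ⟨1, by simp⟩)

theorem isHomog_Vv_pow (n : ℕ) : IsHomog (Vv ^ n) (0, -(2 * n : ℤ)).1 (0, -(2 * n : ℤ)).2 :=
  .inr (.inr ⟨n, by simp⟩)

theorem isHomog_mul {r s : RUV} {d e : ℤ × ℤ} (hr : IsHomog r d.1 d.2) (hs : IsHomog s e.1 e.2) :
    IsHomog (r * s) (d + e).1 (d + e).2 := by
  have h := comp_mul_of_isHomog hs (d + e) r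
  have hr' : comp d r = r := by
    simp [comp, grading_of_isHomog hr]
  rw [add_sub_cancel_right, hr'] at h
  rw [← h]
  exact isHomog_comp _ _

theorem exists_sum_comp (r : RUV) :
    ∃ S : Finset (ℤ × ℤ), ∀ T, S ⊆ T → ∑ d ∈ T, comp d r = r := by
  refine add_induction (P := fun r => ∃ S : Finset (ℤ × ℤ), ∀ T, S ⊆ T → ∑ d ∈ T, comp d r = r)
    (fun n => ⟨{(-(2 * n : ℤ), 0)}, fun T hT => ?_⟩)
    (fun n => ⟨{(0, -(2 * n : ℤ))}, fun T hT => ?_⟩) ⟨∅, by simp⟩ ?_ r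
  · simp only [comp_Uv_pow, Finset.sum_ite_eq', if_pos (Finset.singleton_subset_iff.1 hT)]
  · simp only [comp_Vv_pow, Finset.sum_ite_eq', if_pos (Finset.singleton_subset_iff.1 hT)]
  · rintro r s ⟨S₁, h₁⟩ ⟨S₂, h₂⟩
    refine ⟨S₁ ∪ S₂, fun T hT => ?_⟩
    simp only [map_add, Finset.sum_add_distrib]
    rw [h₁ T (Finset.union_subset_left hT), h₂ T (Finset.union_subset_right hT)]

theorem comp_zero_eq (r : RUV) : comp 0 r = ofPolyV (Polynomial.C ((toPolyV r).coeff 0)) := by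
  refine add_induction (P := fun r => comp 0 r = ofPolyV (Polynomial.C ((toPolyV r).coeff 0)))
    (fun n => ?_) (fun n => ?_) (by simp) (fun r s hr hs => ?_) r
  · rw [comp_Uv_pow]
    rcases n with _ | n
    · simp [Prod.ext_iff]
    · rw [if_neg (by simp [Prod.ext_iff]; omega)]
      simp
  · rw [comp_Vv_pow]
    rcases n with _ | n
    · simp [Prod.ext_iff]
    · rw [if_neg (by simp [Prod.ext_iff]; omega)]
      simp
  · simp only [map_add, hr, hs, Polynomial.coeff_add]

/-- A homogeneous element of `U`-grading zero is zero or a power of `V`. -/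
theorem eq_Vv_pow_of_isHomog {r : RUV} {q : ℤ} (h : IsHomog r 0 q) (hr : r ≠ 0) :
    ∃ b : ℕ, r = Vv ^ b ∧ q = -(2 * b) := by
  obtain h | ⟨a, rfl, ha, rfl⟩ | ⟨b, rfl, -, rfl⟩ := h
  · exact absurd h hr
  · obtain rfl : a = 0 := by omega
    exact ⟨0, by simp⟩
  · exact ⟨b, rfl, rfl⟩

theorem exists_comp_eq_Vv_pow {r : RUV} (h : ¬ Uv ∣ r) :
    ∃ n : ℕ, comp (0, -(2 * n)) r = Vv ^ n := by
  by_contra! H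
  apply h
  obtain ⟨S, hS⟩ := exists_sum_comp r
  rw [← hS S subset_rfl]
  refine Finset.dvd_sum fun d _ => ?_
  obtain h | ⟨a, ha, h1, h2⟩ | ⟨b, hb, h1, h2⟩ := isHomog_comp d r
  · rw [h]; exact dvd_zero _
  · rcases a with _ | a
    · refine absurd ?_ (H 0)
      rw [← show d = (0, -(2 * ((0 : ℕ) : ℤ))) by ext <;> simp_all]
      simpa using ha
    · rw [ha]; exact dvd_pow_self _ (by simp)
  · refine absurd ?_ (H b)
    rw [← show d = (0, -(2 * (b : ℤ))) by ext <;> simp_all]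
    exact hb

theorem Uv_dvd_comp {r : RUV} (h : Uv ∣ r) (d : ℤ × ℤ) : Uv ∣ comp d r := by
  obtain ⟨s, rfl⟩ := h
  rw [comp_mul_of_isHomog_left (e := (-2, 0)) isHomog_Uv]
  exact dvd_mul_right _ _

end RUV

/-! ### Linear algebra over `𝔽₂[X]` -/

section
open Polynomial Matrix

/-- The quotient of a module over a domain by a submodule closed under division by nonzero
scalars is torsion-free. -/
theorem Submodule.isTorsionFree_quotient {A M : Type*} [CommRing A] [IsDomain A] [AddCommGroup M]
    [Module A M] (N : Submodule A M) (hN : ∀ (a : A) (m : M), a ≠ 0 → a • m ∈ N → m ∈ N) :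
    Module.IsTorsionFree A (M ⧸ N) where
  isSMulRegular a ha := by
    intro x y hxy
    obtain ⟨x, rfl⟩ := N.mkQ_surjective x
    obtain ⟨y, rfl⟩ := N.mkQ_surjective y
    simp only [← map_smul] at hxy
    rw [Submodule.mkQ_apply, Submodule.mkQ_apply, Submodule.Quotient.eq, ← smul_sub] at hxy
    rw [Submodule.mkQ_apply, Submodule.mkQ_apply, Submodule.Quotient.eq]
    exact hN a _ ha.ne_zero hxy

/-- A functional whose constant term vanishes on a saturated submodule `N` may be replaced by one
that vanishes on `N` and has the same constant term. -/
theorem exists_functional_of_coeff_zero {F M : Type*} [Field F] [AddCommGroup M] [Module F[X] M]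
    [Module.Finite F[X] M] (N : Submodule F[X] M)
    (hN : ∀ (a : F[X]) (m : M), a ≠ 0 → a • m ∈ N → m ∈ N)
    (φ : M →ₗ[F[X]] F[X]) (hφ : ∀ m ∈ N, (φ m).coeff 0 = 0) :
    ∃ Φ : M →ₗ[F[X]] F[X], (∀ m ∈ N, Φ m = 0) ∧ ∀ m, (Φ m).coeff 0 = (φ m).coeff 0 := by
  have := N.isTorsionFree_quotient hN
  obtain ⟨σ, hσ⟩ := N.mkQ.exists_rightInverse_of_surjective N.range_mkQ
  refine ⟨φ ∘ₗ σ ∘ₗ N.mkQ, fun m hm => ?_, fun m => ?_⟩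
  · rw [LinearMap.comp_apply, LinearMap.comp_apply, N.mkQ_apply,
      (Submodule.Quotient.mk_eq_zero N).2 hm, map_zero, map_zero]
  · have h := LinearMap.congr_fun hσ (N.mkQ m)
    rw [LinearMap.comp_apply, LinearMap.id_apply, N.mkQ_apply (σ _), N.mkQ_apply m,
      Submodule.Quotient.eq] at h
    have := hφ _ h
    rwa [map_sub, coeff_sub, sub_eq_zero] at this

/-- If `h` generates the cycles of `(A^n, D)` modulo torsion and is not itself torsion, then some
functional vanishing on boundaries takes a value with constant term `1` on `h`. -/
theorem exists_tower_functional {n : Type*} [Fintype n]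
    (D : Matrix n n (ZMod 2)[X]) (h : n → (ZMod 2)[X]) (hD : h ᵥ* D = 0) (hDD : D * D = 0)
    (htor : ∀ (a : (ZMod 2)[X]) y, a • h = y ᵥ* D → a = 0)
    (hgen : ∀ z, z ᵥ* D = 0 → ∃ (a b : (ZMod 2)[X]) (y : n → (ZMod 2)[X]), b ≠ 0 ∧
      b • (z - a • h) = y ᵥ* D) :
    ∃ τ : n → (ZMod 2)[X], D *ᵥ τ = 0 ∧ (h ⬝ᵥ τ).coeff 0 = 1 := by
  classical
  let T : Submodule (ZMod 2)[X] (n → (ZMod 2)[X]) :=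
    { carrier := {t | ∃ b : (ZMod 2)[X], b ≠ 0 ∧ ∃ y, b • t = y ᵥ* D}
      zero_mem' := ⟨1, one_ne_zero, 0, by simp⟩
      add_mem' := by
        rintro s t ⟨b, hb, y, hy⟩ ⟨c, hc, z, hz⟩
        refine ⟨b * c, mul_ne_zero hb hc, c • y + b • z, ?_⟩
        rw [add_vecMul, smul_vecMul, smul_vecMul, ← hy, ← hz, smul_add, smul_smul, smul_smul,
          mul_comm c b]
      smul_mem' := by
        rintro a t ⟨b, hb, y, hy⟩
        exact ⟨b, hb, a • y, by rw [smul_comm, hy, smul_vecMul]⟩ }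
  have hT : ∀ (a : (ZMod 2)[X]) (m : n → (ZMod 2)[X]), a ≠ 0 → a • m ∈ T → m ∈ T := by
    rintro a m ha ⟨b, hb, y, hy⟩
    exact ⟨b * a, mul_ne_zero hb ha, y, by rw [mul_smul, hy]⟩
  have hTcyc : ∀ t ∈ T, t ᵥ* D = 0 := by
    rintro t ⟨b, hb, y, hy⟩
    have : b • (t ᵥ* D) = 0 := by
      rw [← smul_vecMul, hy, vecMul_vecMul, hDD, vecMul_zero]
    exact (smul_eq_zero.1 this).resolve_left hb
  have hDT : ∀ y, y ᵥ* D ∈ T := fun y => ⟨1, one_ne_zero, y, one_smul _ _⟩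
  have := T.isTorsionFree_quotient hT
  let B := Module.Free.chooseBasis (ZMod 2)[X] ((n → (ZMod 2)[X]) ⧸ T)
  obtain ⟨i, hi⟩ : ∃ i, (B.repr (T.mkQ h) i).coeff 0 ≠ 0 := by
    by_contra! H
    choose c hc using fun i => X_dvd_iff.2 (H i)
    obtain ⟨y, hy⟩ := T.mkQ_surjective (∑ i, c i • B i)
    have hXy : T.mkQ h = T.mkQ ((X : (ZMod 2)[X]) • y) := by
      rw [map_smul, hy, ← B.sum_repr (T.mkQ h), Finset.smul_sum]
      simp only [hc, mul_smul]
    rw [T.mkQ_apply, T.mkQ_apply, Submodule.Quotient.eq] at hXy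
    have hyc : y ᵥ* D = 0 := by
      have := hTcyc _ hXy
      rw [sub_vecMul, hD, zero_sub, neg_eq_zero, smul_vecMul] at this
      exact (smul_eq_zero.1 this).resolve_left X_ne_zero
    obtain ⟨a, b, w, hb, hw⟩ := hgen y hyc
    have hmem : (1 - X * a) • h ∈ T := by
      have := T.add_mem hXy (T.smul_mem X ⟨b, hb, w, hw⟩)
      convert this using 1
      module
    obtain ⟨d, hd, v, hv⟩ := hmem
    rw [smul_smul] at hv
    have h1 : (1 - X * a : (ZMod 2)[X]) ≠ 0 := fun h0 => by
      simpa using congrArg (fun p => p.coeff 0) h0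
    exact mul_ne_zero hd h1 (htor _ _ hv)
  let Φ : (n → (ZMod 2)[X]) →ₗ[(ZMod 2)[X]] (ZMod 2)[X] := B.coord i ∘ₗ T.mkQ
  have hΦ : ∀ v, v ⬝ᵥ (fun j => Φ (Pi.single j 1)) = Φ v := fun v => by
    conv_rhs => rw [pi_eq_sum_univ' v, map_sum]
    simp [dotProduct]
  refine ⟨fun j => Φ (Pi.single j 1), ?_, ?_⟩
  · ext1 j
    have := hΦ (Pi.single j 1 ᵥ* D)
    rw [← dotProduct_mulVec, single_one_dotProduct] at this
    rw [this]
    change B.coord i (T.mkQ _) = 0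
    rw [T.mkQ_apply, (Submodule.Quotient.mk_eq_zero T).2 (hDT _), map_zero]
  · rw [hΦ]
    exact (by decide : ∀ c : ZMod 2, c ≠ 0 → c = 1) _ hi

/-- A functional on matrices over `F` vanishing on the constant terms of a saturated submodule of
`Mat(F[X])` lifts to a trace pairing vanishing on that submodule. -/
theorem exists_trace_pairing {F m n : Type*} [Field F] [Fintype m] [Fintype n] [DecidableEq m]
    [DecidableEq n]
    (φ : Matrix m n F →ₗ[F] F) (N : Submodule F[X] (Matrix m n F[X]))
    (hN : ∀ (a : F[X]) f, a ≠ 0 → a • f ∈ N → f ∈ N)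
    (hφ : ∀ f ∈ N, φ (f.map (coeff · 0)) = 0) :
    ∃ g : Matrix n m F[X], (∀ f ∈ N, (f * g).trace = 0) ∧
      ∀ f : Matrix m n F[X], ((f * g).trace).coeff 0 = φ (f.map (coeff · 0)) := by
  let g₀ : Matrix n m F[X] := of fun j i => C (φ (single i j 1))
  let φ' : Matrix m n F[X] →ₗ[F[X]] F[X] :=
    traceLinearMap m F[X] F[X] ∘ₗ mulRightLinearMap m F[X] g₀
  have hφ' : ∀ f : Matrix m n F[X], (φ' f).coeff 0 = φ (f.map (coeff · 0)) := fun f => by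
    conv_rhs => rw [matrix_eq_sum_single (f.map (coeff · 0))]
    have : ∀ i j, φ (single i j ((f i j).coeff 0)) = (f i j).coeff 0 * φ (single i j 1) := by
      intro i j
      rw [← smul_eq_mul, ← map_smul, smul_single, smul_eq_mul, mul_one]
    simp [φ', g₀, trace, mul_apply, this]
  obtain ⟨Φ, hΦ, hΦ'⟩ := exists_functional_of_coeff_zero N hN φ' fun f hf => by
    rw [hφ', hφ f hf]
  have key : ∀ f : Matrix m n F[X], (f * (of fun j i => Φ (single i j 1))).trace = Φ f := by
    intro f
    conv_rhs => rw [matrix_eq_sum_single f]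
    have : ∀ i j, Φ (single i j (f i j)) = f i j * Φ (single i j 1) := by
      intro i j
      rw [← smul_eq_mul, ← map_smul, smul_single, smul_eq_mul, mul_one]
    simp [trace, mul_apply, this]
  exact ⟨of fun j i => Φ (single i j 1), fun f hf => by rw [key, hΦ f hf],
    fun f => by rw [key, hΦ', hφ']⟩

/-- If the trace pairing with `g` kills all boundaries of the complex of maps from `D₁` to `D₂`,
then `g` is a chain map from `D₂` to `D₁`. -/
theorem mul_eq_mul_of_trace_eq_zero {A m n : Type*} [CommRing A] [CharP A 2] [Fintype m]
    [Fintype n] [DecidableEq m] [DecidableEq n] {D₁ : Matrix m m A} {D₂ : Matrix n n A}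
    {g : Matrix n m A} (h : ∀ f : Matrix m n A, ((D₁ * f + f * D₂) * g).trace = 0) :
    D₂ * g = g * D₁ := by
  rw [← sub_eq_zero]
  refine ext_iff_trace_mul_left.2 fun f => ?_
  rw [Matrix.mul_zero, trace_zero, ← h f, Matrix.mul_sub, Matrix.add_mul, trace_sub, trace_add,
    CharTwo.sub_eq_add, add_comm, ← Matrix.mul_assoc, ← Matrix.mul_assoc, trace_mul_comm (f * g)]
  simp only [Matrix.mul_assoc]

/-- The matrices of chain maps between complexes with differentials `D₁` and `D₂`. -/
def chainMaps {A m n : Type*} [CommRing A] [Fintype m] [Fintype n] (D₁ : Matrix m m A)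
    (D₂ : Matrix n n A) : Submodule A (Matrix m n A) where
  carrier := {f | D₁ * f = f * D₂}
  zero_mem' := by simp
  add_mem' {a b} (ha : D₁ * a = a * D₂) (hb : D₁ * b = b * D₂) :=
    show D₁ * (a + b) = (a + b) * D₂ by rw [Matrix.mul_add, Matrix.add_mul, ha, hb]
  smul_mem' c a (ha : D₁ * a = a * D₂) :=
    show D₁ * (c • a) = (c • a) * D₂ by rw [Matrix.mul_smul, Matrix.smul_mul, ha]

section chainMaps
variable {A m n : Type*} [CommRing A] [Fintype m] [Fintype n] {D₁ : Matrix m m A}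
  {D₂ : Matrix n n A}

theorem mem_chainMaps {f : Matrix m n A} : f ∈ chainMaps D₁ D₂ ↔ D₁ * f = f * D₂ := Iff.rfl

theorem mem_chainMaps_of_smul_mem [IsDomain A] {a : A} {f : Matrix m n A} (ha : a ≠ 0)
    (h : a • f ∈ chainMaps D₁ D₂) : f ∈ chainMaps D₁ D₂ := by
  rw [mem_chainMaps, Matrix.mul_smul, Matrix.smul_mul] at h
  exact smul_right_injective _ ha h

theorem boundary_mem_chainMaps (h₁ : D₁ * D₁ = 0) (h₂ : D₂ * D₂ = 0) (f : Matrix m n A) :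
    D₁ * f + f * D₂ ∈ chainMaps D₁ D₂ := by
  rw [mem_chainMaps, Matrix.mul_add, Matrix.add_mul, ← Matrix.mul_assoc, h₁, Matrix.mul_assoc f,
    h₂, Matrix.zero_mul, Matrix.mul_zero, zero_add, add_zero, Matrix.mul_assoc]

end chainMaps

/-- A matching pair of chain maps whose effect on towers has constant term `1` exists in one
direction or in the other. -/
theorem exists_local_or_exists_local {m n : Type*} [Fintype m] [Fintype n] [DecidableEq m]
    [DecidableEq n] {D₁ E₁ : Matrix m m (ZMod 2)[X]} {D₂ E₂ : Matrix n n (ZMod 2)[X]}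
    (hE₁ : E₁ * E₁ = 0) (hE₂ : E₂ * E₂ = 0)
    {x₁ τ₁ : m → (ZMod 2)[X]} {x₂ τ₂ : n → (ZMod 2)[X]}
    (hx₁ : x₁ ᵥ* D₁ = 0) (hx₂ : x₂ ᵥ* D₂ = 0) (hτ₁ : D₁ *ᵥ τ₁ = 0) (hτ₂ : D₂ *ᵥ τ₂ = 0)
    (h₁ : (x₁ ⬝ᵥ τ₁).coeff 0 = 1) (h₂ : (x₂ ⬝ᵥ τ₂).coeff 0 = 1) (hDD₁ : D₁ * D₁ = 0)
    (hDD₂ : D₂ * D₂ = 0) :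
    (∃ f g : Matrix m n (ZMod 2)[X], D₁ * f = f * D₂ ∧ E₁ * g = g * E₂ ∧
      (∀ i j, (f i j).coeff 0 = (g i j).coeff 0) ∧ ((x₁ ᵥ* f) ⬝ᵥ τ₂).coeff 0 = 1) ∨
    (∃ f g : Matrix n m (ZMod 2)[X], D₂ * f = f * D₁ ∧ E₂ * g = g * E₁ ∧
      (∀ i j, (f i j).coeff 0 = (g i j).coeff 0) ∧ ((x₂ ᵥ* f) ⬝ᵥ τ₁).coeff 0 = 1) := by
  let red : Matrix m n (ZMod 2)[X] →ₗ[ZMod 2] Matrix m n (ZMod 2) := (lcoeff (ZMod 2) 0).mapMatrix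
  let ev : Matrix m n (ZMod 2)[X] →ₗ[(ZMod 2)[X]] (ZMod 2)[X] :=
    { toFun := fun f => (x₁ ᵥ* f) ⬝ᵥ τ₂
      map_add' := fun a b => by rw [vecMul_add, add_dotProduct]
      map_smul' := fun c a => by rw [vecMul_smul, smul_dotProduct, RingHom.id_apply] }
  let K := chainMaps E₁ E₂
  let S := chainMaps D₁ D₂ ⊓ LinearMap.ker ev
  have hS : ∀ (a : (ZMod 2)[X]) f, a ≠ 0 → a • f ∈ S → f ∈ S := by
    rintro a f ha ⟨hf, hf'⟩
    refine ⟨mem_chainMaps_of_smul_mem ha hf, ?_⟩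
    rw [SetLike.mem_coe, LinearMap.mem_ker, map_smul] at hf'
    exact (smul_eq_zero.1 hf').resolve_left ha
  have hbS : ∀ f : Matrix m n (ZMod 2)[X], D₁ * f + f * D₂ ∈ S := fun f => by
    refine ⟨boundary_mem_chainMaps hDD₁ hDD₂ f, ?_⟩
    change (x₁ ᵥ* (D₁ * f + f * D₂)) ⬝ᵥ τ₂ = 0
    rw [vecMul_add, ← vecMul_vecMul, hx₁, zero_vecMul, zero_add, ← vecMul_vecMul,
      ← dotProduct_mulVec, hτ₂, dotProduct_zero]
  let a₀ : Matrix m n (ZMod 2)[X] := vecMulVec τ₁ x₂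
  have ha₀ : D₁ * a₀ = a₀ * D₂ := by
    rw [mul_vecMulVec, vecMulVec_mul, hτ₁, hx₂]
    ext i j
    simp [vecMulVec_apply]
  have hev : ((x₁ ᵥ* a₀) ⬝ᵥ τ₂).coeff 0 = 1 := by
    rw [vecMul_vecMulVec, smul_dotProduct, smul_eq_mul, mul_coeff_zero, h₁, h₂, one_mul]
  let W := (S.restrictScalars (ZMod 2)).map red ⊔ (K.restrictScalars (ZMod 2)).map red
  by_cases hW : red a₀ ∈ W
  · left
    obtain ⟨_, ⟨s, hs, rfl⟩, _, ⟨k, hk, rfl⟩, hsk⟩ := Submodule.mem_sup.1 hW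
    refine ⟨a₀ - s, k, ?_, hk, fun i j => ?_, ?_⟩
    · rw [Matrix.mul_sub, Matrix.sub_mul, ha₀, mem_chainMaps.1 hs.1]
    · have := congrFun (congrFun hsk i) j
      rw [Matrix.sub_apply, coeff_sub, sub_eq_iff_eq_add']
      exact this.symm
    · rw [vecMul_sub, sub_dotProduct, show (x₁ ᵥ* s) ⬝ᵥ τ₂ = 0 from hs.2, sub_zero, hev]
  · right
    obtain ⟨φ, hφ, hφW⟩ := Submodule.exists_le_ker_of_notMem hW
    obtain ⟨f, hf, hf'⟩ := exists_trace_pairing φ S hS fun s hs =>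
      hφW (Submodule.mem_sup_left ⟨s, hs, rfl⟩)
    obtain ⟨g, hg, hg'⟩ :=
      exists_trace_pairing φ K (fun _ _ => mem_chainMaps_of_smul_mem) fun s hs =>
      hφW (Submodule.mem_sup_right ⟨s, hs, rfl⟩)
    refine ⟨f, g, mul_eq_mul_of_trace_eq_zero fun s => hf _ (hbS s),
      mul_eq_mul_of_trace_eq_zero fun s => hg _ (boundary_mem_chainMaps hE₁ hE₂ s),
      fun i j => ?_, ?_⟩
    · have := (hf' (single j i 1)).trans (hg' (single j i 1)).symm
      simpa [trace_single_mul] using this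
    · have := hf' a₀
      rw [vecMulVec_mul, trace_vecMulVec, dotProduct_comm] at this
      rw [this]
      exact (by decide : ∀ c : ZMod 2, c ≠ 0 → c = 1) _ hφ

end

/-! ### Homogeneous components of chains -/

section
open RUV Matrix

variable {ι κ : Type*}

/-- The component of bidegree `d` of an element of the free `R`-module on generators of
bidegrees `gr`. -/
noncomputable def vcomp (gr : ι → ℤ × ℤ) (d : ℤ × ℤ) : (ι → RUV) →+ (ι → RUV) where
  toFun x j := comp (d - gr j) (x j)
  map_zero' := by ext1 j; exact map_zero _
  map_add' x y := by ext1 j; exact map_add _ _ _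

/-- `x` is homogeneous of bidegree `d`. -/
def VecHomog (gr : ι → ℤ × ℤ) (x : ι → RUV) (d : ℤ × ℤ) : Prop :=
  ∀ j, IsHomog (x j) (d - gr j).1 (d - gr j).2

theorem vecHomog_vcomp (gr : ι → ℤ × ℤ) (d : ℤ × ℤ) (x : ι → RUV) :
    VecHomog gr (vcomp gr d x) d := fun _ => isHomog_comp _ _

theorem vcomp_smul (gr : ι → ℤ × ℤ) {r : RUV} {e : ℤ × ℤ} (hr : IsHomog r e.1 e.2) (d : ℤ × ℤ)
    (x : ι → RUV) : vcomp gr (d + e) (r • x) = r • vcomp gr d x := by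
  ext1 j
  change comp _ (r * x j) = r * comp _ (x j)
  rw [comp_mul_of_isHomog_left hr]
  congr 2
  abel_nf

theorem vcomp_smul_of_vecHomog {gr : ι → ℤ × ℤ} {x : ι → RUV} {e : ℤ × ℤ} (hx : VecHomog gr x e)
    (d : ℤ × ℤ) (r : RUV) : vcomp gr (d + e) (r • x) = comp d r • x := by
  ext1 j
  change comp _ (r * x j) = comp _ r * x j
  rw [comp_mul_of_isHomog (hx j)]
  congr 2
  abel_nf

theorem vcomp_vecMul [Fintype ι] {gr : ι → ℤ × ℤ} {gr' : κ → ℤ × ℤ} {G : Matrix ι κ RUV} {e : ℤ × ℤ}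
    (hG : ∀ i, VecHomog gr' (G i) (gr i + e)) (d : ℤ × ℤ) (x : ι → RUV) :
    vcomp gr' (d + e) (x ᵥ* G) = vcomp gr d x ᵥ* G := by
  ext1 j
  change comp _ (∑ i, x i * G i j) = ∑ i, comp _ (x i) * G i j
  rw [map_sum]
  refine Finset.sum_congr rfl fun i _ => ?_
  rw [comp_mul_of_isHomog (hG i j)]
  congr 2
  abel_nf

theorem exists_sum_vcomp [Fintype ι] (gr : ι → ℤ × ℤ) (x : ι → RUV) :
    ∃ S : Finset (ℤ × ℤ), ∑ d ∈ S, vcomp gr d x = x := by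
  classical
  choose S hS using fun j => exists_sum_comp (x j)
  set T := Finset.univ.biUnion fun j => (S j).map (Equiv.addRight (gr j)).toEmbedding
  refine ⟨T, ?_⟩
  ext1 j
  rw [Finset.sum_apply]
  conv_rhs => rw [← hS j (T.map (Equiv.subRight (gr j)).toEmbedding) fun d hd =>
    Finset.mem_map.2 ⟨d + gr j, Finset.mem_biUnion.2
      ⟨j, Finset.mem_univ _, Finset.mem_map.2 ⟨d, hd, rfl⟩⟩, by simp⟩, Finset.sum_map]
  rfl

/-- The part of bidegree `s` of a matrix. -/
noncomputable def matrixComp (gr : ι → ℤ × ℤ) (gr' : κ → ℤ × ℤ) (s : ℤ × ℤ) (F : Matrix ι κ RUV) :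
    Matrix ι κ RUV := of fun i => vcomp gr' (gr i + s) (F i)

theorem vecMul_matrixComp [Fintype ι] {gr : ι → ℤ × ℤ} (gr' : κ → ℤ × ℤ) {x : ι → RUV} {d : ℤ × ℤ}
    (hx : VecHomog gr x d) (s : ℤ × ℤ) (F : Matrix ι κ RUV) :
    x ᵥ* matrixComp gr gr' s F = vcomp gr' (d + s) (x ᵥ* F) := by
  ext1 j
  change ∑ i, x i * comp _ (F i j) = comp _ (∑ i, x i * F i j)
  rw [map_sum]
  refine Finset.sum_congr rfl fun i _ => ?_
  rw [comp_mul_of_isHomog_left (hx i)]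
  congr 2
  abel_nf

theorem mul_matrixComp [Fintype ι] [Fintype κ] {gr : ι → ℤ × ℤ} {gr' : κ → ℤ × ℤ}
    {D : Matrix ι ι RUV} {D' : Matrix κ κ RUV} {e : ℤ × ℤ}
    (hD : ∀ i, VecHomog gr (D i) (gr i + e)) (hD' : ∀ i, VecHomog gr' (D' i) (gr' i + e))
    {F : Matrix ι κ RUV} (hF : D * F = F * D') (s : ℤ × ℤ) :
    D * matrixComp gr gr' s F = matrixComp gr gr' s F * D' := by
  refine funext fun i => ?_
  rw [mul_apply_eq_vecMul, mul_apply_eq_vecMul, vecMul_matrixComp gr' (hD i),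
    ← mul_apply_eq_vecMul, hF, mul_apply_eq_vecMul, add_right_comm]
  exact vcomp_vecMul hD' _ _

/-- The vectors divisible by `U`. -/
def uVec (ι : Type*) : Submodule RUV (ι → RUV) where
  carrier := {x | ∀ j, Uv ∣ x j}
  zero_mem' _ := dvd_zero _
  add_mem' hx hy j := dvd_add (hx j) (hy j)
  smul_mem' r _ hx j := (hx j).mul_left r

theorem mem_uVec {x : ι → RUV} : x ∈ uVec ι ↔ toPolyV ∘ x = 0 := by
  simp only [funext_iff, Function.comp_apply, Pi.zero_apply, toPolyV_eq_zero_iff]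
  rfl

theorem vcomp_mem_uVec (gr : ι → ℤ × ℤ) (d : ℤ × ℤ) {x : ι → RUV} (hx : x ∈ uVec ι) :
    vcomp gr d x ∈ uVec ι := fun j => Uv_dvd_comp (hx j) _

/-- The reduction of a matrix modulo `U`. -/
noncomputable abbrev Matrix.modU (D : Matrix ι κ RUV) : Matrix ι κ (Polynomial (ZMod 2)) :=
  D.map toPolyV

theorem toPolyV_comp_vecMul [Fintype ι] (x : ι → RUV) (D : Matrix ι κ RUV) :
    toPolyV ∘ (x ᵥ* D) = (toPolyV ∘ x) ᵥ* D.modU := funext fun i => toPolyV.map_vecMul D x i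

theorem vecMul_mem_uVec [Fintype ι] (D : Matrix ι κ RUV) {x : ι → RUV} (hx : x ∈ uVec ι) :
    x ᵥ* D ∈ uVec κ := by
  rw [mem_uVec] at hx ⊢
  rw [toPolyV_comp_vecMul, hx, zero_vecMul]

/-! ### The `V`-tower -/

variable [Fintype ι] [Fintype κ]

/-- The cycles modulo `U`. -/
noncomputable def cyclesU (D : Matrix ι ι RUV) : Submodule RUV (ι → RUV) :=
  (uVec ι).comap D.vecMulLinear

/-- The boundaries modulo `U`. -/
noncomputable def boundariesU (D : Matrix ι ι RUV) : Submodule RUV (ι → RUV) :=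
  uVec ι ⊔ D.vecMulLinear.range

/-- The chains with `V`-torsion class in the homology modulo `U`. -/
noncomputable def torsionU (D : Matrix ι ι RUV) : Submodule RUV (ι → RUV) where
  carrier := {x | ∃ k : ℕ, Vv ^ k • x ∈ boundariesU D}
  zero_mem' := ⟨0, by simp⟩
  add_mem' := by
    rintro x y ⟨k, hx⟩ ⟨l, hy⟩
    refine ⟨k + l, ?_⟩
    rw [smul_add]
    refine add_mem ?_ ?_
    · rw [pow_add, mul_comm, mul_smul]
      exact Submodule.smul_mem _ _ hx
    · rw [pow_add, mul_smul]
      exact Submodule.smul_mem _ _ hy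
  smul_mem' := by
    rintro r x ⟨k, hx⟩
    exact ⟨k, by rw [smul_comm]; exact Submodule.smul_mem _ _ hx⟩

/-- `x` generates the cycles modulo `U` and torsion. -/
structure IsTowerGen (D : Matrix ι ι RUV) (x : ι → RUV) : Prop where
  mem_cyclesU : x ∈ cyclesU D
  notMem_torsionU : x ∉ torsionU D
  exists_sub_smul_mem : ∀ z ∈ cyclesU D, ∃ r : RUV, z - r • x ∈ torsionU D

theorem mem_cyclesU {D : Matrix ι ι RUV} {x : ι → RUV} :
    x ∈ cyclesU D ↔ (toPolyV ∘ x) ᵥ* D.modU = 0 := by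
  rw [← toPolyV_comp_vecMul, ← mem_uVec]
  rfl

theorem mem_boundariesU {D : Matrix ι ι RUV} {x : ι → RUV} :
    x ∈ boundariesU D ↔ ∃ y, toPolyV ∘ x = y ᵥ* D.modU := by
  constructor
  · intro hx
    obtain ⟨u, hu, _, ⟨y, rfl⟩, rfl⟩ := Submodule.mem_sup.1 hx
    refine ⟨toPolyV ∘ y, ?_⟩
    rw [← toPolyV_comp_vecMul]
    ext1 j
    simp [toPolyV_eq_zero_iff.2 (hu j)]
  · rintro ⟨y, hy⟩
    refine Submodule.mem_sup.2 ⟨x - (ofPolyV ∘ y) ᵥ* D, ?_, _, ⟨ofPolyV ∘ y, rfl⟩, ?_⟩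
    · have : toPolyV ∘ ofPolyV ∘ y = y := by ext1; simp
      rw [mem_uVec]
      ext1 j
      have h₁ := congrFun hy j
      have h₂ := congrFun (toPolyV_comp_vecMul (ofPolyV ∘ y) D) j
      rw [this] at h₂
      simp only [Function.comp_apply] at h₁ h₂
      simp [h₁, h₂]
    · exact sub_add_cancel _ _

theorem boundariesU_le_torsionU (D : Matrix ι ι RUV) : boundariesU D ≤ torsionU D :=
  fun x hx => ⟨0, by simpa using hx⟩

theorem mem_torsionU_of_smul {D : Matrix ι ι RUV} {x : ι → RUV} (k : ℕ)
    (h : Vv ^ k • x ∈ torsionU D) : x ∈ torsionU D := by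
  obtain ⟨l, hl⟩ := h
  exact ⟨l + k, by rwa [pow_add, mul_smul]⟩

theorem smul_mem_torsionU_of_dvd (D : Matrix ι ι RUV) {r : RUV} (hr : Uv ∣ r) (x : ι → RUV) :
    r • x ∈ torsionU D :=
  boundariesU_le_torsionU D (Submodule.mem_sup_left fun j => hr.mul_right (x j))

section homogeneous
variable {gr : ι → ℤ × ℤ} {D : Matrix ι ι RUV} {e : ℤ × ℤ}
  {x h h' : ι → RUV} {q q' : ℤ}

theorem vcomp_mem_cyclesU (hD : ∀ i, VecHomog gr (D i) (gr i + e)) (d : ℤ × ℤ)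
    (hx : x ∈ cyclesU D) : vcomp gr d x ∈ cyclesU D := by
  change vcomp gr d x ᵥ* D ∈ uVec ι
  rw [← vcomp_vecMul hD]
  exact vcomp_mem_uVec _ _ hx

theorem vcomp_mem_boundariesU (hD : ∀ i, VecHomog gr (D i) (gr i + e)) (d : ℤ × ℤ)
    (hx : x ∈ boundariesU D) : vcomp gr d x ∈ boundariesU D := by
  obtain ⟨u, hu, _, ⟨y, rfl⟩, rfl⟩ := Submodule.mem_sup.1 hx
  rw [map_add]
  refine add_mem (Submodule.mem_sup_left (vcomp_mem_uVec _ _ hu)) (Submodule.mem_sup_right ?_)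
  refine ⟨vcomp gr (d - e) y, ?_⟩
  have := vcomp_vecMul hD (d - e) y
  rw [sub_add_cancel] at this
  exact this.symm

theorem vcomp_mem_torsionU (hD : ∀ i, VecHomog gr (D i) (gr i + e)) (d : ℤ × ℤ)
    (hx : x ∈ torsionU D) : vcomp gr d x ∈ torsionU D := by
  obtain ⟨k, hk⟩ := hx
  refine ⟨k, ?_⟩
  rw [← vcomp_smul gr (isHomog_Vv_pow k)]
  exact vcomp_mem_boundariesU hD _ hk

/-- A homogeneous nontorsion chain is not annihilated modulo torsion by any element outside
`(U)`. -/
theorem Uv_dvd_of_smul_mem_torsionU (hD : ∀ i, VecHomog gr (D i) (gr i + e)) {d : ℤ × ℤ}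
    (hh : VecHomog gr h d) (hT : h ∉ torsionU D)
    {r : RUV} (hr : r • h ∈ torsionU D) : Uv ∣ r := by
  by_contra H
  obtain ⟨n, hn⟩ := exists_comp_eq_Vv_pow H
  have := vcomp_mem_torsionU hD ((0, -(2 * n : ℤ)) + d) hr
  rw [vcomp_smul_of_vecHomog hh, hn] at this
  exact hT (mem_torsionU_of_smul n this)

/-- Among homogeneous nontorsion cycles of `U`-grading zero, one of larger `V`-grading generates
one of smaller `V`-grading modulo torsion. -/
theorem exists_sub_smul_mem_torsionU (hD : ∀ i, VecHomog gr (D i) (gr i + e))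
    (hx : IsTowerGen D x) (hh : VecHomog gr h (0, q))
    (hh' : VecHomog gr h' (0, q')) (hq : q' ≤ q) (hZ : h ∈ cyclesU D) (hZ' : h' ∈ cyclesU D)
    (hT : h ∉ torsionU D) (hT' : h' ∉ torsionU D) : ∃ r : RUV, h' - r • h ∈ torsionU D := by
  obtain ⟨r, hr⟩ := hx.exists_sub_smul_mem h hZ
  obtain ⟨r', hr'⟩ := hx.exists_sub_smul_mem h' hZ'
  have hU : ¬ Uv ∣ r' := fun hU => hT' <| by
    simpa using add_mem hr' (smul_mem_torsionU_of_dvd D hU x)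
  obtain ⟨n, hn⟩ := exists_comp_eq_Vv_pow hU
  have key : r' • h - r • h' ∈ torsionU D := by
    convert sub_mem ((torsionU D).smul_mem r' hr) ((torsionU D).smul_mem r hr') using 1
    module
  have key' := vcomp_mem_torsionU hD ((0, -(2 * n : ℤ)) + (0, q)) key
  rw [map_sub, vcomp_smul_of_vecHomog hh, hn,
    show ((0, -(2 * n : ℤ)) + (0, q) : ℤ × ℤ) = (0, q - q' - 2 * n) + (0, q') from
      Prod.ext rfl (by simp only [Prod.snd_add]; ring), vcomp_smul_of_vecHomog hh'] at key'
  by_cases h0 : comp (0, q - q' - 2 * n) r = 0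
  · rw [h0, zero_smul, sub_zero] at key'
    exact absurd (mem_torsionU_of_smul n key') hT
  · obtain ⟨b, hb, hb'⟩ := eq_Vv_pow_of_isHomog (isHomog_comp _ _) h0
    rw [hb] at key'
    obtain ⟨c, rfl⟩ : ∃ c, n = b + c := Nat.exists_eq_add_of_le (by
      simp only at hb'
      omega)
    refine ⟨Vv ^ c, neg_mem_iff.1 (mem_torsionU_of_smul b ?_)⟩
    convert key' using 1
    rw [pow_add]
    module

/-- The tower has a homogeneous generator, provided nontorsion homogeneous cycles have
`U`-grading zero. -/
theorem exists_homogeneous_isTowerGen (hD : ∀ i, VecHomog gr (D i) (gr i + e)) (hx : IsTowerGen D x)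
    (hgr : ∀ y d, VecHomog gr y d → y ∈ cyclesU D → y ∉ torsionU D → d.1 = 0) :
    ∃ h q, IsTowerGen D h ∧ VecHomog gr h (0, q) := by
  classical
  obtain ⟨S, hS⟩ := exists_sum_vcomp gr x
  have hZ := fun d => vcomp_mem_cyclesU hD d hx.mem_cyclesU
  have hne : (S.filter fun d => vcomp gr d x ∉ torsionU D).Nonempty := by
    by_contra! H
    refine hx.notMem_torsionU (hS ▸ sum_mem fun d hd => ?_)
    by_contra hd'
    exact Finset.notMem_empty d (H ▸ Finset.mem_filter.2 ⟨hd, hd'⟩)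
  obtain ⟨d₀, hd₀, hmax⟩ := Finset.exists_max_image _ Prod.snd hne
  rw [Finset.mem_filter] at hd₀
  have hdeg : ∀ d, vcomp gr d x ∉ torsionU D → VecHomog gr (vcomp gr d x) (0, d.2) := by
    intro d hd
    have h0 := hgr _ d (vecHomog_vcomp gr d x) (hZ d) hd
    rw [← h0]
    exact vecHomog_vcomp gr d x
  have hρ : ∀ d, ∃ r : RUV, d ∈ S → vcomp gr d x - r • vcomp gr d₀ x ∈ torsionU D := by
    intro d
    by_cases hd : d ∈ S ∧ vcomp gr d x ∉ torsionU D
    · obtain ⟨r, hr⟩ := exists_sub_smul_mem_torsionU hD hx (hdeg d₀ hd₀.2) (hdeg d hd.2)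
        (hmax d (Finset.mem_filter.2 hd)) (hZ d₀) (hZ d) hd₀.2 hd.2
      exact ⟨r, fun _ => hr⟩
    · exact ⟨0, fun hdS => by simpa [hdS] using hd⟩
  choose ρ hρ using hρ
  have hsum : x - (∑ d ∈ S, ρ d) • vcomp gr d₀ x ∈ torsionU D := by
    nth_rewrite 1 [← hS]
    rw [Finset.sum_smul, ← Finset.sum_sub_distrib]
    exact sum_mem hρ
  refine ⟨_, d₀.2, ⟨hZ d₀, hd₀.2, fun z hz => ?_⟩, hdeg d₀ hd₀.2⟩
  obtain ⟨r, hr⟩ := hx.exists_sub_smul_mem z hz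
  refine ⟨r * ∑ d ∈ S, ρ d, ?_⟩
  convert add_mem hr ((torsionU D).smul_mem r hsum) using 1
  module

/-- A functional on `C/U` that vanishes on boundaries and has constant term `1` on a homogeneous
tower generator. -/
theorem exists_functional_of_isTowerGen (hD : ∀ i, VecHomog gr (D i) (gr i + e)) {d : ℤ × ℤ}
    (hh : IsTowerGen D h) (hd : VecHomog gr h d)
    (hDD : D * D = 0) :
    ∃ τ, D.modU *ᵥ τ = 0 ∧ ((toPolyV ∘ h) ⬝ᵥ τ).coeff 0 = 1 := by
  have hof : ∀ y : ι → Polynomial (ZMod 2), toPolyV ∘ ofPolyV ∘ y = y := fun y => by ext1; simp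
  refine exists_tower_functional _ _ (mem_cyclesU.1 hh.mem_cyclesU) ?_ ?_ ?_
  · rw [← Matrix.map_mul, hDD, Matrix.map_zero _ (map_zero _)]
  · intro a y hy
    have : ofPolyV a • h ∈ boundariesU D := mem_boundariesU.2 ⟨y, by
      rw [← hy]; ext1; simp⟩
    have := Uv_dvd_of_smul_mem_torsionU hD hd hh.notMem_torsionU (boundariesU_le_torsionU D this)
    simpa using toPolyV_eq_zero_iff.2 this
  · intro z hz
    obtain ⟨r, k, hk⟩ := hh.exists_sub_smul_mem (ofPolyV ∘ z) (mem_cyclesU.2 (by rwa [hof]))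
    obtain ⟨y, hy⟩ := mem_boundariesU.1 hk
    refine ⟨toPolyV r, Polynomial.X ^ k, y, pow_ne_zero _ Polynomial.X_ne_zero, ?_⟩
    rw [← hy]
    ext1
    simp

end homogeneous

theorem dotProduct_eq_zero_of_mem_torsionU {D : Matrix ι ι RUV} {x : ι → RUV}
    {τ : ι → Polynomial (ZMod 2)} (hτ : D.modU *ᵥ τ = 0) (hx : x ∈ torsionU D) :
    (toPolyV ∘ x) ⬝ᵥ τ = 0 := by
  obtain ⟨k, hk⟩ := hx
  obtain ⟨y, hy⟩ := mem_boundariesU.1 hk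
  have h : toPolyV ∘ (Vv ^ k • x) = (Polynomial.X ^ k : Polynomial (ZMod 2)) • (toPolyV ∘ x) := by
    ext1; simp
  have := congrArg (· ⬝ᵥ τ) hy
  simp only [h] at this
  rw [smul_dotProduct, ← dotProduct_mulVec, hτ, dotProduct_zero] at this
  exact (smul_eq_zero.1 this).resolve_left (pow_ne_zero _ Polynomial.X_ne_zero)

section chainMap
variable {D : Matrix ι ι RUV} {D' : Matrix κ κ RUV} {F : Matrix ι κ RUV} {x : ι → RUV}

theorem vecMul_mem_cyclesU (hF : D * F = F * D') (hx : x ∈ cyclesU D) : x ᵥ* F ∈ cyclesU D' := by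
  change x ᵥ* F ᵥ* D' ∈ uVec κ
  rw [vecMul_vecMul, ← hF, ← vecMul_vecMul]
  exact vecMul_mem_uVec F hx

theorem vecMul_mem_torsionU (hF : D * F = F * D') (hx : x ∈ torsionU D) : x ᵥ* F ∈ torsionU D' := by
  obtain ⟨k, hk⟩ := hx
  refine ⟨k, ?_⟩
  rw [← smul_vecMul]
  obtain ⟨u, hu, _, ⟨y, rfl⟩, hy⟩ := Submodule.mem_sup.1 hk
  rw [← hy, add_vecMul]
  refine add_mem (Submodule.mem_sup_left (vecMul_mem_uVec F hu))
    (Submodule.mem_sup_right ⟨y ᵥ* F, ?_⟩)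
  change y ᵥ* F ᵥ* D' = y ᵥ* D ᵥ* F
  rw [vecMul_vecMul, ← hF, vecMul_vecMul]

/-- A chain map taking one tower generator to another modulo torsion takes every tower generator
to a tower generator. -/
theorem IsTowerGen.vecMul (hF : D * F = F * D') {h : ι → RUV} {h' : κ → RUV} (hh : h ∈ cyclesU D)
    (hx : IsTowerGen D x) (hh' : IsTowerGen D' h') (hmap : h ᵥ* F - h' ∈ torsionU D') :
    IsTowerGen D' (x ᵥ* F) := by
  obtain ⟨r, hr⟩ := hx.exists_sub_smul_mem h hh
  have key : h' - r • (x ᵥ* F) ∈ torsionU D' := by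
    have := sub_mem (vecMul_mem_torsionU hF hr) hmap
    rw [sub_vecMul, smul_vecMul] at this
    convert this using 1
    module
  refine ⟨vecMul_mem_cyclesU hF hx.mem_cyclesU, fun H => hh'.notMem_torsionU ?_, fun z hz => ?_⟩
  · simpa using add_mem key ((torsionU D').smul_mem r H)
  · obtain ⟨s, hs⟩ := hh'.exists_sub_smul_mem z hz
    refine ⟨s * r, ?_⟩
    convert add_mem hs ((torsionU D').smul_mem s key) using 1
    module

end chainMap

/-- A chain map modulo torsion of constant term `1` on homogeneous tower generators may be replaced
by a homogeneous chain map that preserves tower generators. -/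
theorem exists_homogeneous_chainMap {gr : ι → ℤ × ℤ} {gr' : κ → ℤ × ℤ} {D : Matrix ι ι RUV}
    {D' : Matrix κ κ RUV} {e : ℤ × ℤ} (hD : ∀ i, VecHomog gr (D i) (gr i + e))
    (hD' : ∀ i, VecHomog gr' (D' i) (gr' i + e)) {h : ι → RUV} {h' : κ → RUV} {q q' : ℤ}
    (hh : IsTowerGen D h) (hh' : IsTowerGen D' h') (hq : VecHomog gr h (0, q))
    (hq' : VecHomog gr' h' (0, q')) {τ : κ → Polynomial (ZMod 2)} (hτ : D'.modU *ᵥ τ = 0)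
    (hτ' : ((toPolyV ∘ h') ⬝ᵥ τ).coeff 0 = 1) {F : Matrix ι κ RUV} (hF : D * F = F * D')
    (hFτ : (((toPolyV ∘ h) ᵥ* F.modU) ⬝ᵥ τ).coeff 0 = 1) :
    ∃ G : Matrix ι κ RUV, D * G = G * D' ∧ (∀ i, VecHomog gr' (G i) (gr i + (0, q' - q))) ∧
      ∀ x, IsTowerGen D x → IsTowerGen D' (x ᵥ* G) := by
  have hG := mul_matrixComp hD hD' hF (0, q' - q)
  refine ⟨_, hG, fun i => vecHomog_vcomp _ _ _,
    fun x hx => IsTowerGen.vecMul hG hh.mem_cyclesU hx hh' ?_⟩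
  obtain ⟨r, hr⟩ := hh'.exists_sub_smul_mem _ (vecMul_mem_cyclesU hF hh.mem_cyclesU)
  have hr0 : (toPolyV r).coeff 0 = 1 := by
    have := dotProduct_eq_zero_of_mem_torsionU hτ hr
    have hsub : toPolyV ∘ (h ᵥ* F - r • h') =
        (toPolyV ∘ h) ᵥ* F.modU - toPolyV r • (toPolyV ∘ h') := by
      rw [← toPolyV_comp_vecMul]; ext1; simp
    rw [hsub, sub_dotProduct, sub_eq_zero, smul_dotProduct, smul_eq_mul] at this
    rwa [this, Polynomial.mul_coeff_zero, hτ', mul_one] at hFτ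
  have := vcomp_mem_torsionU hD' (0 + (0, q')) hr
  rw [map_sub, vcomp_smul_of_vecHomog hq', comp_zero_eq, hr0, map_one, map_one, one_smul] at this
  rw [vecMul_matrixComp gr' hq]
  convert this using 3
  ext
  simp

end

/-! ### Local maps -/

namespace PreCx
open RUV Matrix

/-- The differential of `C` as a matrix. -/
def matrix (C : PreCx) : Matrix (Fin C.n) (Fin C.n) RUV := C.dm

theorem coe_dmap (C : PreCx) (x : Msub C) : ⇑(dmap C x) = ⇑x ᵥ* C.matrix := by
  ext1 j
  simp only [dmap, Finsupp.linearCombination_apply, Finsupp.sum_fintype, zero_smul, implies_true,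
    Finsupp.finsetSum_apply, Finsupp.smul_apply, Finsupp.single_apply, vecMul, dotProduct, matrix]
  simp

end PreCx

section
open RUV Matrix PreCx

/-- The linear map with a given matrix. -/
noncomputable def finsuppMap {ι κ : Type*} [Finite κ] (G : Matrix ι κ RUV) :
    (ι →₀ RUV) →ₗ[RUV] (κ →₀ RUV) :=
  Finsupp.linearCombination RUV fun i => Finsupp.equivFunOnFinite.symm (G i)

theorem coe_finsuppMap {ι κ : Type*} [Fintype ι] [Finite κ] (G : Matrix ι κ RUV) (x : ι →₀ RUV) :
    ⇑(finsuppMap G x) = ⇑x ᵥ* G := by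
  ext1 j
  simp [finsuppMap, Finsupp.linearCombination_apply, Finsupp.sum_fintype, vecMul, dotProduct]

theorem mem_uSub {C : PreCx} {x : Msub C} : x ∈ uSub C ↔ ⇑x ∈ uVec (Fin C.n) := by
  constructor
  · rintro ⟨y, rfl⟩ j
    exact ⟨y j, rfl⟩
  · intro h
    choose y hy using h
    exact ⟨Finsupp.equivFunOnFinite.symm y, by ext1 j; exact (hy j).symm⟩

theorem dmap_mem_uSub {C : PreCx} {x : Msub C} :
    dmap C x ∈ uSub C ↔ ⇑x ∈ cyclesU C.matrix := by
  rw [mem_uSub, coe_dmap]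
  rfl

theorem mem_bdryU {C : PreCx} {x : Msub C} : x ∈ bdryU C ↔ ⇑x ∈ boundariesU C.matrix := by
  constructor
  · intro hx
    obtain ⟨u, hu, _, ⟨y, rfl⟩, rfl⟩ := Submodule.mem_sup.1 hx
    exact Submodule.mem_sup.2 ⟨u, mem_uSub.1 hu, _, ⟨y, rfl⟩, by
      rw [Finsupp.coe_add, coe_dmap]; rfl⟩
  · intro hx
    obtain ⟨u, hu, _, ⟨y, rfl⟩, h⟩ := Submodule.mem_sup.1 hx
    refine Submodule.mem_sup.2 ⟨Finsupp.equivFunOnFinite.symm u, mem_uSub.2 hu, _,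
      ⟨Finsupp.equivFunOnFinite.symm y, rfl⟩, DFunLike.coe_injective ?_⟩
    rw [Finsupp.coe_add, coe_dmap]
    exact h

theorem forall_notMem_bdryU {C : PreCx} {x : Msub C} :
    (∀ k : ℕ, Vv ^ k • x ∉ bdryU C) ↔ ⇑x ∉ torsionU C.matrix := by
  rw [← not_exists]
  simp only [mem_bdryU]
  rfl

theorem isVTowerGen_iff {C : PreCx} {x : Msub C} :
    IsVTowerGen C x ↔ IsTowerGen C.matrix x := by
  refine ⟨fun ⟨h₁, h₂, h₃⟩ => ⟨dmap_mem_uSub.1 h₁, forall_notMem_bdryU.1 h₂, fun z hz => ?_⟩,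
    fun ⟨h₁, h₂, h₃⟩ => ⟨dmap_mem_uSub.2 h₁, forall_notMem_bdryU.2 h₂, fun z hz => ?_⟩⟩
  · obtain ⟨r, k, hk⟩ := h₃ (Finsupp.equivFunOnFinite.symm z) (dmap_mem_uSub.2 hz)
    exact ⟨r, k, mem_bdryU.1 hk⟩
  · obtain ⟨r, k, hk⟩ := h₃ z (dmap_mem_uSub.1 hz)
    exact ⟨r, k, mem_bdryU.2 hk⟩

theorem IsKnotLike.matrix_mul_self {C : PreCx} (hC : IsKnotLike C) : C.matrix * C.matrix = 0 := by
  refine ext_of_single_vecMul fun i => ?_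
  have := congrArg (⇑) (hC.dsq (Finsupp.single i 1))
  rw [coe_dmap, coe_dmap, vecMul_vecMul, Finsupp.single_eq_pi_single] at this
  rw [this, vecMul_zero]
  rfl

theorem IsKnotLike.vecHomog_matrix {C : PreCx} (hC : IsKnotLike C) (i : Fin C.n) :
    VecHomog C.gr (C.matrix i) (C.gr i + (-1, -1)) := hC.dhomog i

theorem IsKnotLike.exists_homogeneous_isTowerGen {C : PreCx} (hC : IsKnotLike C) :
    ∃ h q, IsTowerGen C.matrix h ∧ VecHomog C.gr h (0, q) := by
  obtain ⟨x, hx⟩ := hC.vTowerExists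
  refine _root_.exists_homogeneous_isTowerGen hC.vecHomog_matrix (isVTowerGen_iff.1 hx) ?_
  intro y d hd hy hy'
  exact hC.vTowerGr (Finsupp.equivFunOnFinite.symm y) d.1 d.2 hd (dmap_mem_uSub.2 hy)
    (forall_notMem_bdryU.2 hy')

theorem localLE_of_matrix {C₁ C₂ : PreCx} {G : Matrix (Fin C₁.n) (Fin C₂.n) RUV} {s : ℤ}
    (hG : C₁.matrix * G = G * C₂.matrix) (hs : ∀ i, VecHomog C₂.gr (G i) (C₁.gr i + (0, s)))
    (ht : ∀ x, IsTowerGen C₁.matrix x → IsTowerGen C₂.matrix (x ᵥ* G)) : LocalLE C₁ C₂ := by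
  refine ⟨finsuppMap G, fun x => DFunLike.coe_injective ?_, ⟨s, fun i j => ?_⟩, fun x hx => ?_⟩
  · rw [coe_finsuppMap, coe_dmap, coe_dmap, coe_finsuppMap, vecMul_vecMul, hG, vecMul_vecMul]
  · rw [coe_finsuppMap, Finsupp.single_eq_pi_single, single_one_vecMul]
    exact hs i j
  · rw [isVTowerGen_iff, coe_finsuppMap]
    exact ht x (isVTowerGen_iff.1 hx)

theorem localLE_of_chainMaps {C₁ C₂ : PreCx} (hC₁ : IsKnotLike C₁) (hC₂ : IsKnotLike C₂)
    {h₁ : Fin C₁.n → RUV} {h₂ : Fin C₂.n → RUV} {q₁ q₂ : ℤ} (hh₁ : IsTowerGen C₁.matrix h₁)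
    (hh₂ : IsTowerGen C₂.matrix h₂) (hq₁ : VecHomog C₁.gr h₁ (0, q₁))
    (hq₂ : VecHomog C₂.gr h₂ (0, q₂)) {τ : Fin C₂.n → Polynomial (ZMod 2)}
    (hτ : C₂.matrix.modU *ᵥ τ = 0) (hτ' : ((toPolyV ∘ h₂) ⬝ᵥ τ).coeff 0 = 1)
    (H : ∃ f g : Matrix (Fin C₁.n) (Fin C₂.n) (Polynomial (ZMod 2)),
      C₁.matrix.modU * f = f * C₂.matrix.modU ∧
      C₁.matrix.map toPolyU * g = g * C₂.matrix.map toPolyU ∧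
      (∀ i j, (f i j).coeff 0 = (g i j).coeff 0) ∧
      (((toPolyV ∘ h₁) ᵥ* f) ⬝ᵥ τ).coeff 0 = 1) : LocalLE C₁ C₂ := by
  obtain ⟨f, g, hf, hg, hfg, hfτ⟩ := H
  choose F₀ hFU hFV using fun i j => exists_toPoly (hfg i j).symm
  let F : Matrix (Fin C₁.n) (Fin C₂.n) RUV := F₀
  obtain rfl : F.map toPolyV = f := by ext1 i j; exact hFV i j
  obtain rfl : F.map toPolyU = g := by ext1 i j; exact hFU i j
  have hF : C₁.matrix * F = F * C₂.matrix := by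
    ext1 i j
    rw [← sub_eq_zero]
    apply eq_zero_of_toPoly
    · rw [← Matrix.map_mul, ← Matrix.map_mul] at hg
      rw [map_sub, sub_eq_zero]
      exact congrFun (congrFun hg i) j
    · rw [← Matrix.map_mul, ← Matrix.map_mul] at hf
      rw [map_sub, sub_eq_zero]
      exact congrFun (congrFun hf i) j
  obtain ⟨G, hG, hs, ht⟩ := exists_homogeneous_chainMap hC₁.vecHomog_matrix hC₂.vecHomog_matrix
    hh₁ hh₂ hq₁ hq₂ hτ hτ' hF hfτ
  exact localLE_of_matrix hG hs ht

theorem localLE_total {C₁ C₂ : PreCx} (hC₁ : IsKnotLike C₁) (hC₂ : IsKnotLike C₂) :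
    LocalLE C₁ C₂ ∨ LocalLE C₂ C₁ := by
  obtain ⟨h₁, q₁, hh₁, hq₁⟩ := hC₁.exists_homogeneous_isTowerGen
  obtain ⟨h₂, q₂, hh₂, hq₂⟩ := hC₂.exists_homogeneous_isTowerGen
  have hsq₁ := hC₁.matrix_mul_self
  have hsq₂ := hC₂.matrix_mul_self
  obtain ⟨τ₁, hτ₁, hτ₁'⟩ := exists_functional_of_isTowerGen hC₁.vecHomog_matrix hh₁ hq₁ hsq₁
  obtain ⟨τ₂, hτ₂, hτ₂'⟩ := exists_functional_of_isTowerGen hC₂.vecHomog_matrix hh₂ hq₂ hsq₂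
  have hmap : ∀ {n : ℕ} {D : Matrix (Fin n) (Fin n) RUV} (φ : RUV →+* Polynomial (ZMod 2)),
      D * D = 0 → D.map φ * D.map φ = 0 := fun φ h => by
    rw [← Matrix.map_mul, h, Matrix.map_zero _ (map_zero _)]
  refine (exists_local_or_exists_local (hmap toPolyU hsq₁) (hmap toPolyU hsq₂)
    (mem_cyclesU.1 hh₁.mem_cyclesU) (mem_cyclesU.1 hh₂.mem_cyclesU) hτ₁ hτ₂ hτ₁' hτ₂'
    (hmap toPolyV hsq₁) (hmap toPolyV hsq₂)).imp ?_ ?_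
  · exact localLE_of_chainMaps hC₁ hC₂ hh₁ hh₂ hq₁ hq₂ hτ₂ hτ₂'
  · exact localLE_of_chainMaps hC₂ hC₁ hh₂ hh₁ hq₂ hq₁ hτ₁ hτ₁'

end

theorem LocalLE.refl (C : PreCx) : LocalLE C C := by
  refine ⟨LinearMap.id, fun _ => rfl, ⟨0, fun i j => ?_⟩, fun _ hx => hx⟩
  rw [LinearMap.id_apply, Finsupp.single_apply]
  split_ifs with h
  · subst h
    exact .inr (.inl ⟨0, by simp⟩)
  · exact .zero _ _

theorem LocalLE.trans {C₁ C₂ C₃ : PreCx} : LocalLE C₁ C₂ → LocalLE C₂ C₃ → LocalLE C₁ C₃ := by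
  rintro ⟨f, hf, ⟨s, hs⟩, hft⟩ ⟨g, hg, ⟨t, ht⟩, hgt⟩
  refine ⟨g ∘ₗ f, fun x => ?_, ⟨s + t, fun i j => ?_⟩, fun x hx => hgt _ (hft x hx)⟩
  · rw [LinearMap.comp_apply, hf, hg, LinearMap.comp_apply]
  · have hsum : g (f (Finsupp.single i 1)) j =
        ∑ k, f (Finsupp.single i 1) k * g (Finsupp.single k 1) j := by
      conv_lhs => rw [← Finsupp.univ_sum_single (f (Finsupp.single i 1)), map_sum,
        Finsupp.finsetSum_apply]
      refine Finset.sum_congr rfl fun k _ => ?_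
      rw [← mul_one (f (Finsupp.single i 1) k), ← smul_eq_mul, ← Finsupp.smul_single, map_smul,
        Finsupp.smul_apply, smul_eq_mul, smul_eq_mul, mul_one]
    rw [LinearMap.comp_apply, hsum]
    refine IsHomog.sum fun k _ => ?_
    convert RUV.isHomog_mul (d := (_, _)) (e := (_, _)) (hs i k) (ht k j) using 1
    · simp only [Prod.fst_add]; ring
    · simp only [Prod.snd_add]; ring

/-- The relation `≤` (existence of a local map) defines a total order
on local equivalence classes of knot-like complexes: it is reflexive, transitive,
antisymmetric on local equivalence classes, and total. -/
theorem localLE_total_order :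
    (∀ C : PreCx, IsKnotLike C → LocalLE C C) ∧
    (∀ C₁ C₂ C₃ : PreCx, IsKnotLike C₁ → IsKnotLike C₂ → IsKnotLike C₃ →
      LocalLE C₁ C₂ → LocalLE C₂ C₃ → LocalLE C₁ C₃) ∧
    (∀ C₁ C₂ : PreCx, IsKnotLike C₁ → IsKnotLike C₂ →
      LocalLE C₁ C₂ → LocalLE C₂ C₁ → LocalEquiv C₁ C₂) ∧
    (∀ C₁ C₂ : PreCx, IsKnotLike C₁ → IsKnotLike C₂ →
      LocalLE C₁ C₂ ∨ LocalLE C₂ C₁) :=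
  ⟨fun C _ => .refl C, fun _ _ _ _ _ _ => .trans, fun _ _ _ _ h₁ h₂ => ⟨h₁, h₂⟩,
    fun _ _ => localLE_total⟩
end

section
/- The set KL of local equivalence classes of knot-like complexes, with operation induced by tensor product over R, forms an abelian group: the tensor product of two knot-like complexes is a knot-like complex, the operation is well defined on local equivalence classes, associative and commutative, the class of R (with trivial differential) is the identity, and the inverse of the class [C] is [C^∨], where C^∨ = Hom_R(C, R). -/
/-!
Common setup: the ring `R = 𝔽₂[U,V]/(UV = 0)`, bigraded free finitely generated chain
complexes over `R` ("pre-complexes"), knot-like complexes, local maps and local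
equivalence, standard and semistandard complexes, short maps, the `Z^!` order,
the invariants `a_i`, `φ_j`, `P`, shift maps, tensor products, duals, and direct sums.
-/

set_option synthInstance.maxHeartbeats 1000000
set_option maxHeartbeats 1000000

namespace KnotLike

open Polynomial Matrix

/-! ### Towers in differential modules over `𝔽₂[X]` -/

section Tower

variable {ι κ : Type*} [Fintype ι] [Fintype κ] [DecidableEq ι] [DecidableEq κ]

/-- The row vector `x` is a cycle of the differential `y ↦ y ᵥ* M` whose class is not
`X`-torsion and generates the homology modulo `X`-torsion. -/
structure IsTower (M : Matrix ι ι (ZMod 2)[X]) (x : ι → (ZMod 2)[X]) : Prop where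
  cycle : x ᵥ* M = 0
  nontorsion : ∀ k : ℕ, ¬ ∃ y, y ᵥ* M = (X : (ZMod 2)[X]) ^ k • x
  generates : ∀ z, z ᵥ* M = 0 →
    ∃ (r : (ZMod 2)[X]) (k : ℕ), ∃ y, y ᵥ* M = (X : (ZMod 2)[X]) ^ k • (z - r • x)

/-- A cycle `x` and a cocycle `ε` with `ε x = 1` such that the projection `y ↦ ε(y) x` is
homotopic to the identity after multiplication by a power of `X`. -/
structure IsSplitting (M : Matrix ι ι (ZMod 2)[X]) (x ε : ι → (ZMod 2)[X]) : Prop where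
  cycle : x ᵥ* M = 0
  cocycle : M *ᵥ ε = 0
  pairing : x ⬝ᵥ ε = 1
  homotopy : ∃ (h : Matrix ι ι (ZMod 2)[X]) (m : ℕ),
    (X : (ZMod 2)[X]) ^ m • (1 - vecMulVec ε x) = h * M + M * h

lemma IsSplitting.cycle_homotopy {M : Matrix ι ι (ZMod 2)[X]} {x ε : ι → (ZMod 2)[X]}
    (hs : IsSplitting M x ε) :
    ∃ (h : Matrix ι ι (ZMod 2)[X]) (m : ℕ), ∀ z, z ᵥ* M = 0 →
      (z ᵥ* h) ᵥ* M = (X : (ZMod 2)[X]) ^ m • (z - (z ⬝ᵥ ε) • x) := by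
  obtain ⟨h, m, hm⟩ := hs.homotopy
  refine ⟨h, m, fun z hz => ?_⟩
  have := congrArg (fun N => z ᵥ* N) hm
  simp only [vecMul_smul, vecMul_sub, vecMul_one, vecMul_vecMulVec, vecMul_add,
    ← vecMul_vecMul, hz, zero_vecMul, add_zero] at this
  exact this.symm

lemma cancel_X_pow {m : ℕ} {a b : (ZMod 2)[X]} (h : X ^ m * a = X ^ m * b) : a = b :=
  mul_left_cancel₀ (pow_ne_zero m X_ne_zero) h

lemma IsSplitting.dot_boundary {M : Matrix ι ι (ZMod 2)[X]} {x ε : ι → (ZMod 2)[X]}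
    (hs : IsSplitting M x ε) (y : ι → (ZMod 2)[X]) : (y ᵥ* M) ⬝ᵥ ε = 0 := by
  rw [← dotProduct_mulVec, hs.cocycle, dotProduct_zero]

lemma IsSplitting.isTower_iff {M : Matrix ι ι (ZMod 2)[X]} {x ε : ι → (ZMod 2)[X]}
    (hs : IsSplitting M x ε) (x' : ι → (ZMod 2)[X]) :
    IsTower M x' ↔ x' ᵥ* M = 0 ∧ IsUnit (x' ⬝ᵥ ε) := by
  constructor
  · intro ht
    refine ⟨ht.cycle, ?_⟩
    obtain ⟨r, k, y, hy⟩ := ht.generates x hs.cycle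
    have h := hs.dot_boundary y
    rw [hy, smul_dotProduct, sub_dotProduct, smul_dotProduct, hs.pairing, smul_eq_mul,
      smul_eq_mul] at h
    have h1 : 1 - r * (x' ⬝ᵥ ε) = 0 := cancel_X_pow (m := k) (by rw [h, mul_zero])
    exact IsUnit.of_mul_eq_one r (by rw [mul_comm]; exact (sub_eq_zero.1 h1).symm)
  · rintro ⟨hc, hu⟩
    refine ⟨hc, ?_, ?_⟩
    · rintro k ⟨y, hy⟩
      have h := hs.dot_boundary y
      rw [hy, smul_dotProduct, smul_eq_mul] at h
      exact hu.ne_zero (cancel_X_pow (m := k) (by rw [h, mul_zero]))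
    · intro z hz
      obtain ⟨h, m, hm⟩ := hs.cycle_homotopy
      obtain ⟨v, hv⟩ := hu.exists_left_inv
      refine ⟨(z ⬝ᵥ ε) * v, m, z ᵥ* h - ((z ⬝ᵥ ε) * v) • (x' ᵥ* h), ?_⟩
      rw [sub_vecMul, smul_vecMul, hm z hz, hm x' hc]
      ext1 i
      simp only [Pi.sub_apply, Pi.smul_apply, smul_eq_mul]
      linear_combination (-X ^ m * (z ⬝ᵥ ε) * x i) * -hv

lemma IsSplitting.transpose {M : Matrix ι ι (ZMod 2)[X]} {x ε : ι → (ZMod 2)[X]}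
    (hs : IsSplitting M x ε) : IsSplitting Mᵀ ε x := by
  obtain ⟨h, m, hm⟩ := hs.homotopy
  refine ⟨by rw [vecMul_transpose, hs.cocycle], by rw [mulVec_transpose, hs.cycle],
    by rw [dotProduct_comm, hs.pairing], hᵀ, m, ?_⟩
  have := congrArg Matrix.transpose hm
  simp only [transpose_smul, transpose_sub, transpose_one, transpose_vecMulVec, transpose_add,
    transpose_mul] at this
  rw [this, add_comm]

lemma IsSplitting.submatrix {M : Matrix ι ι (ZMod 2)[X]} {x ε : ι → (ZMod 2)[X]}
    (hs : IsSplitting M x ε) (e : κ ≃ ι) :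
    IsSplitting (M.submatrix e e) (x ∘ e) (ε ∘ e) := by
  obtain ⟨h, m, hm⟩ := hs.homotopy
  refine ⟨?_, ?_, ?_, h.submatrix e e, m, ?_⟩
  · rw [submatrix_vecMul_equiv, Function.comp_assoc, Equiv.self_comp_symm, Function.comp_id,
      hs.cycle]
    rfl
  · rw [submatrix_mulVec_equiv, Function.comp_assoc, Equiv.self_comp_symm, Function.comp_id,
      hs.cocycle]
    rfl
  · rw [comp_equiv_dotProduct_comp_equiv, hs.pairing]
  · have := congrArg (fun N => N.submatrix e e) hm
    rw [submatrix_mul_equiv, submatrix_mul_equiv]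
    refine Eq.trans ?_ this
    ext1 i j
    simp [Matrix.one_apply, vecMulVec_apply]

/-- The tensor product of two vectors. -/
def tensorVec {R : Type*} [Mul R] (x : ι → R) (y : κ → R) : ι × κ → R := fun p => x p.1 * y p.2

/-- The matrix of the differential on the tensor product. -/
def tensorMat {R : Type*} [CommRing R] (M : Matrix ι ι R) (N : Matrix κ κ R) :
    Matrix (ι × κ) (ι × κ) R :=
  kroneckerMap (· * ·) M 1 + kroneckerMap (· * ·) 1 N

omit [DecidableEq ι] [DecidableEq κ] in
lemma tensorVec_vecMul {R : Type*} [CommRing R] {ι' κ' : Type*} (x : ι → R) (y : κ → R)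
    (M : Matrix ι ι' R) (N : Matrix κ κ' R) :
    tensorVec x y ᵥ* kroneckerMap (· * ·) M N = tensorVec (x ᵥ* M) (y ᵥ* N) := by
  ext1 p
  simp only [vecMul, dotProduct, tensorVec, kroneckerMap_apply, Fintype.sum_prod_type,
    Finset.sum_mul_sum]
  exact Finset.sum_congr rfl fun i _ => Finset.sum_congr rfl fun j _ => by ring

omit [DecidableEq ι] [DecidableEq κ] in
lemma tensorVec_dotProduct {R : Type*} [CommRing R] (x ε : ι → R) (y δ : κ → R) :
    tensorVec x y ⬝ᵥ tensorVec ε δ = (x ⬝ᵥ ε) * (y ⬝ᵥ δ) := by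
  simp only [dotProduct, tensorVec, Fintype.sum_prod_type, Finset.sum_mul_sum]
  exact Finset.sum_congr rfl fun i _ => Finset.sum_congr rfl fun j _ => by ring

omit [Fintype ι] [Fintype κ] in
lemma tensorMat_transpose {R : Type*} [CommRing R] (M : Matrix ι ι R) (N : Matrix κ κ R) :
    (tensorMat M N)ᵀ = tensorMat Mᵀ Nᵀ := by
  simp [tensorMat, transpose_add, ← kroneckerMap_transpose]

lemma tensorMat_mul_self {R : Type*} [CommRing R] [CharP R 2] {M : Matrix ι ι R}
    {N : Matrix κ κ R} (hM : M * M = 0) (hN : N * N = 0) :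
    tensorMat M N * tensorMat M N = 0 := by
  simp only [tensorMat, mul_add, add_mul, ← mul_kronecker_mul, mul_one, one_mul, hM, hN]
  ext1 p q
  simp [CharTwo.add_self_eq_zero]

lemma IsSplitting.tensor {M : Matrix ι ι (ZMod 2)[X]} {N : Matrix κ κ (ZMod 2)[X]}
    {x ε : ι → (ZMod 2)[X]} {y δ : κ → (ZMod 2)[X]}
    (hM : IsSplitting M x ε) (hN : IsSplitting N y δ) :
    IsSplitting (tensorMat M N) (tensorVec x y) (tensorVec ε δ) := by
  obtain ⟨h, m, hm⟩ := hM.homotopy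
  obtain ⟨k, n, hn⟩ := hN.homotopy
  have cyc : ∀ {M : Matrix ι ι (ZMod 2)[X]} {N : Matrix κ κ (ZMod 2)[X]}
      {x : ι → (ZMod 2)[X]} {y : κ → (ZMod 2)[X]}, x ᵥ* M = 0 → y ᵥ* N = 0 →
      tensorVec x y ᵥ* tensorMat M N = 0 := by
    intro M N x y h1 h2
    rw [tensorMat, vecMul_add, tensorVec_vecMul, tensorVec_vecMul, h1, h2]
    ext1 p
    simp [tensorVec]
  refine ⟨cyc hM.cycle hN.cycle, ?_, ?_, ?_⟩
  · rw [← vecMul_transpose, tensorMat_transpose]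
    exact cyc (by rw [vecMul_transpose, hM.cocycle]) (by rw [vecMul_transpose, hN.cocycle])
  · rw [tensorVec_dotProduct, hM.pairing, hN.pairing, one_mul]
  · have e1 : vecMulVec ε x * M = 0 := by rw [vecMulVec_mul, hM.cycle, vecMulVec_zero]
    have e2 : M * vecMulVec ε x = 0 := by rw [mul_vecMulVec, hM.cocycle, zero_vecMulVec]
    refine ⟨kroneckerMap (· * ·) ((X : (ZMod 2)[X]) ^ n • h) 1 +
      kroneckerMap (· * ·) ((X : (ZMod 2)[X]) ^ m • vecMulVec ε x) k, m + n, ?_⟩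
    simp only [tensorMat, mul_add, add_mul, ← mul_kronecker_mul, mul_one, one_mul, smul_mul_assoc,
      mul_smul_comm, e1, e2]
    ext1 ⟨i, j⟩ ⟨i', j'⟩
    have h1 := congrFun₂ hm i i'
    have h2 := congrFun₂ hn j j'
    simp only [Matrix.smul_apply, Matrix.sub_apply, Matrix.add_apply, kroneckerMap_apply,
      vecMulVec_apply, tensorVec, smul_eq_mul, Matrix.zero_apply] at h1 h2 ⊢
    have h3 : (1 : Matrix (ι × κ) (ι × κ) (ZMod 2)[X]) (i, j) (i', j') =
        (1 : Matrix ι ι (ZMod 2)[X]) i i' * (1 : Matrix κ κ (ZMod 2)[X]) j j' := by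
      simp only [one_apply, Prod.mk.injEq, ite_and, ite_mul, one_mul, zero_mul]
    have h4 := CharTwo.add_self_eq_zero (X ^ n * h i i' * N j j')
    rw [h3]
    linear_combination X ^ n * (1 : Matrix κ κ (ZMod 2)[X]) j j' * h1 +
      X ^ m * ε i * x i' * h2 - h4

end Tower

/-! ### Bigraded differential modules over `𝔽₂[X]` -/

section Graded

variable {ι κ : Type*} [Fintype ι] [Fintype κ] [DecidableEq ι] [DecidableEq κ]

open Classical in
/-- The part of the vector `y` supported on the monomials `X ^ c eᵢ` with `S i c`. -/
noncomputable def part (S : ι → ℕ → Prop) (y : ι → (ZMod 2)[X]) : ι → (ZMod 2)[X] :=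
  fun i => ∑ c ∈ (y i).support with S i c, monomial c ((y i).coeff c)

omit [Fintype ι] [DecidableEq ι] in
open Classical in
lemma coeff_part (S : ι → ℕ → Prop) (y : ι → (ZMod 2)[X]) (i : ι) (c : ℕ) :
    (part S y i).coeff c = if S i c then (y i).coeff c else 0 := by
  simp only [part, finsetSum_coeff, coeff_monomial, Finset.sum_ite_eq', Finset.mem_filter,
    mem_support_iff]
  by_cases h : S i c <;> by_cases h' : (y i).coeff c = 0 <;> simp [h, h']

omit [DecidableEq ι] [DecidableEq κ] [Fintype κ] in
lemma part_vecMul {S : ι → ℕ → Prop} {S' : κ → ℕ → Prop} {M : Matrix ι κ (ZMod 2)[X]}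
    (hM : ∀ i j, M i j = 0 ∨ ∃ a : ℕ, M i j = X ^ a ∧ ∀ c, S i c ↔ S' j (c + a))
    (y : ι → (ZMod 2)[X]) : part S' (y ᵥ* M) = part S y ᵥ* M := by
  classical
  ext j c
  rw [coeff_part]
  simp only [vecMul, dotProduct, finsetSum_coeff]
  trans ∑ i, if S' j c then (y i * M i j).coeff c else 0
  · split_ifs <;> simp
  refine Finset.sum_congr rfl fun i _ => ?_
  rcases hM i j with h | ⟨a, h, hS⟩
  · simp [h]
  · rw [h, coeff_mul_X_pow', coeff_mul_X_pow', coeff_part]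
    by_cases hac : a ≤ c
    · have := hS (c - a)
      rw [Nat.sub_add_cancel hac] at this
      simp [hac, this]
    · simp [hac]

/-- The differential `M` has degree `(-1, -1)`, where `X` has degree `(0, -2)`. -/
def IsGraded (M : Matrix ι ι (ZMod 2)[X]) (g : ι → ℤ × ℤ) : Prop :=
  ∀ i j, M i j = 0 ∨ ∃ a : ℕ, M i j = X ^ a ∧ (g j).1 = (g i).1 - 1 ∧
    (g j).2 = (g i).2 - 1 + 2 * a

/-- The vector `w` is homogeneous of degree `(p, q)`. -/
def IsBihomog (g : ι → ℤ × ℤ) (w : ι → (ZMod 2)[X]) (p q : ℤ) : Prop :=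
  ∀ i c, (w i).coeff c ≠ 0 → (g i).1 = p ∧ (g i).2 - 2 * c = q

/-- Homogeneous cycles whose class is not `X`-torsion lie in first degree `0`. -/
def TowersInDegreeZero (M : Matrix ι ι (ZMod 2)[X]) (g : ι → ℤ × ℤ) : Prop :=
  ∀ w p q, IsBihomog g w p q → w ᵥ* M = 0 →
    (∀ k : ℕ, ¬ ∃ y, y ᵥ* M = (X : (ZMod 2)[X]) ^ k • w) → p = 0

omit [DecidableEq ι] in
lemma IsGraded.mem_boundaries_of_one_add {M : Matrix ι ι (ZMod 2)[X]} {g : ι → ℤ × ℤ}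
    (hg : IsGraded M g) {r : (ZMod 2)[X]} {z y : ι → (ZMod 2)[X]}
    (h : y ᵥ* M = (1 + X * r) • z) : ∃ y', y' ᵥ* M = z := by
  classical
  set B : ℕ := ∑ i, ((g i).2.natAbs + (z i).natDegree) with hB
  have hBi : ∀ i, (g i).2.natAbs + (z i).natDegree ≤ B := fun i =>
    Finset.single_le_sum (f := fun i => (g i).2.natAbs + (z i).natDegree)
      (fun _ _ => Nat.zero_le _) (Finset.mem_univ i)
  set N : ℕ := 2 ^ (2 * B)
  have hN : 2 * B < N := Nat.lt_two_pow_self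
  have hp : (1 + X * r) ^ N = 1 + X ^ N * r ^ N := by
    rw [add_pow_char_pow, one_pow, mul_pow]
  have hy : ((1 + X * r) ^ (N - 1) • y) ᵥ* M = z + (X ^ N * r ^ N) • z := by
    rw [smul_vecMul, h, smul_smul, ← pow_succ, Nat.sub_add_cancel (by omega), hp, add_smul,
      one_smul]
  refine ⟨part (fun i c => ∃ j d, (z j).coeff d ≠ 0 ∧ (g j).2 - 2 * d + 1 ≤ (g i).2 - 2 * c)
    ((1 + X * r) ^ (N - 1) • y), ?_⟩
  rw [← part_vecMul (S' := fun i c => ∃ j d, (z j).coeff d ≠ 0 ∧ (g j).2 - 2 * d ≤ (g i).2 - 2 * c),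
    hy]
  · ext i c
    rw [coeff_part]
    split_ifs with hS
    · obtain ⟨j, d, hd, hjd⟩ := hS
      have h1 := hBi i
      have h2 := hBi j
      have h3 := le_natDegree_of_ne_zero hd
      have hc : c < N := by omega
      simp only [Pi.add_apply, Pi.smul_apply, smul_eq_mul, coeff_add, mul_assoc]
      rw [coeff_X_pow_mul', if_neg (by omega), add_zero]
    · by_contra hne
      exact hS ⟨i, c, fun h0 => hne h0.symm, le_rfl⟩
  · intro i j
    refine (hg i j).imp id fun ⟨a, ha, _, h2⟩ => ⟨a, ha, fun c => ?_⟩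
    refine exists_congr fun k => exists_congr fun d => and_congr_right fun _ => ?_
    push_cast
    omega

omit [DecidableEq ι] in
lemma IsGraded.torsion {M : Matrix ι ι (ZMod 2)[X]} {g : ι → ℤ × ℤ}
    (hg : IsGraded M g) {p : (ZMod 2)[X]} (hp : p ≠ 0) {z y : ι → (ZMod 2)[X]}
    (h : y ᵥ* M = p • z) : ∃ (k : ℕ) (y' : _), y' ᵥ* M = (X : (ZMod 2)[X]) ^ k • z := by
  obtain ⟨q, hq, hnd⟩ := exists_eq_pow_rootMultiplicity_mul_and_not_dvd p hp 0
  rw [C_0, sub_zero] at hq hnd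
  have hq0 : q.coeff 0 = 1 := by
    rw [X_dvd_iff] at hnd
    generalize q.coeff 0 = a at hnd
    revert a
    decide
  have hq1 : q = 1 + X * q.divX := by
    conv_lhs => rw [← X_mul_divX_add q, hq0, C_1, add_comm]
  refine ⟨p.rootMultiplicity 0, hg.mem_boundaries_of_one_add (r := q.divX) (y := y) ?_⟩
  rw [h, ← hq1, smul_smul, mul_comm q, ← hq]

theorem IsTower.exists_splitting {M : Matrix ι ι (ZMod 2)[X]} {g : ι → ℤ × ℤ}
    (hg : IsGraded M g) (hsq : M * M = 0) {x : ι → (ZMod 2)[X]} (hx : IsTower M x) :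
    ∃ ε, IsSplitting M x ε := by
  set d : (ι → (ZMod 2)[X]) →ₗ[(ZMod 2)[X]] (ι → (ZMod 2)[X]) := M.vecMulLinear with hd
  have d_apply : ∀ y, d y = y ᵥ* M := fun y => rfl
  have dd : ∀ y, d (d y) = 0 := fun y => by
    rw [d_apply, d_apply, vecMul_vecMul, hsq, vecMul_zero]
  obtain ⟨s, hs⟩ := Module.projective_lifting_property d.rangeRestrict LinearMap.id
    d.surjective_rangeRestrict
  have ds : ∀ b : LinearMap.range d, d (s b) = b := fun b =>
    congrArg Subtype.val (LinearMap.congr_fun hs b)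
  have uniq : ∀ (r : (ZMod 2)[X]) (k : ℕ), (X : (ZMod 2)[X]) ^ k • r • x ∈ LinearMap.range d →
      r = 0 := by
    rintro r k ⟨y, hy⟩
    by_contra hr
    obtain ⟨k', h'⟩ := hg.torsion (mul_ne_zero (pow_ne_zero k X_ne_zero) hr)
      (hy.trans (smul_smul _ _ _))
    exact hx.nontorsion k' h'
  have ex : ∀ z : LinearMap.ker d, ∃ (r : (ZMod 2)[X]) (k : ℕ),
      (X : (ZMod 2)[X]) ^ k • ((z : ι → (ZMod 2)[X]) - r • x) ∈ LinearMap.range d :=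
    fun z => hx.generates z z.2
  choose r e hr using ex
  have eq_r : ∀ (z : LinearMap.ker d) (a : (ZMod 2)[X]) (k : ℕ),
      (X : (ZMod 2)[X]) ^ k • ((z : ι → (ZMod 2)[X]) - a • x) ∈ LinearMap.range d → r z = a := by
    intro z a k h
    refine sub_eq_zero.1 (uniq _ (k + e z) ?_)
    have := sub_mem (Submodule.smul_mem _ ((X : (ZMod 2)[X]) ^ e z) h)
      (Submodule.smul_mem _ ((X : (ZMod 2)[X]) ^ k) (hr z))
    convert this using 1
    module
  let φ : LinearMap.ker d →ₗ[(ZMod 2)[X]] (ZMod 2)[X] :=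
    { toFun := r
      map_add' := fun z w => eq_r _ _ (e z + e w) (by
        have := add_mem (Submodule.smul_mem _ ((X : (ZMod 2)[X]) ^ e w) (hr z))
          (Submodule.smul_mem _ ((X : (ZMod 2)[X]) ^ e z) (hr w))
        convert this using 1
        push_cast
        module)
      map_smul' := fun a z => eq_r _ _ (e z) (by
        have := Submodule.smul_mem _ a (hr z)
        convert this using 1
        simp only [RingHom.id_apply, smul_eq_mul, Submodule.coe_smul]
        module) }
  let π : (ι → (ZMod 2)[X]) →ₗ[(ZMod 2)[X]] LinearMap.ker d :=
    (LinearMap.id - s ∘ₗ d.rangeRestrict).codRestrict _ fun y => by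
      simp [ds]
  have π_apply : ∀ y, ((π y : LinearMap.ker d) : ι → (ZMod 2)[X]) = y - s (d.rangeRestrict y) :=
    fun y => rfl
  have π_cycle : ∀ z : LinearMap.ker d, π z = z := fun z => by
    ext1
    rw [π_apply]
    have : d.rangeRestrict z = 0 := Subtype.ext z.2
    rw [this, map_zero, sub_zero]
  have φ_d : ∀ y, φ (π (d y)) = 0 := fun y => by
    rw [π_cycle ⟨d y, dd y⟩]
    exact eq_r _ _ 0 ⟨y, by simp⟩
  have φ_x : φ (π x) = 1 := by
    rw [π_cycle ⟨x, hx.cycle⟩]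
    exact eq_r _ _ 0 ⟨0, by simp⟩
  -- a uniform exponent
  let L : (ι → (ZMod 2)[X]) →ₗ[(ZMod 2)[X]] (ι → (ZMod 2)[X]) :=
    (LinearMap.ker d).subtype ∘ₗ π - (φ ∘ₗ π).smulRight x
  have L_apply : ∀ y, L y = (π y : ι → (ZMod 2)[X]) - φ (π y) • x := fun y => rfl
  let m : ℕ := ∑ i, e (π (Pi.single i 1))
  have hm : ∀ y, (X : (ZMod 2)[X]) ^ m • L y ∈ LinearMap.range d := by
    have : (LinearMap.range d).comap ((X : (ZMod 2)[X]) ^ m • L) = ⊤ := by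
      rw [eq_top_iff, ← (Pi.basisFun (ZMod 2)[X] ι).span_eq, Submodule.span_le]
      rintro _ ⟨i, rfl⟩
      have hle : e (π (Pi.single i 1)) ≤ m :=
        Finset.single_le_sum (f := fun i => e (π (Pi.single i 1))) (fun _ _ => Nat.zero_le _)
          (Finset.mem_univ i)
      have := Submodule.smul_mem _ ((X : (ZMod 2)[X]) ^ (m - e (π (Pi.single i 1))))
        (hr (π (Pi.single i 1)))
      rw [smul_smul, ← pow_add, Nat.sub_add_cancel hle] at this
      change ((X : (ZMod 2)[X]) ^ m • L) (Pi.basisFun (ZMod 2)[X] ι i) ∈ LinearMap.range d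
      rw [Pi.basisFun_apply]
      exact this
    intro y
    exact this.ge (Submodule.mem_top (x := y))
  let h : (ι → (ZMod 2)[X]) →ₗ[(ZMod 2)[X]] (ι → (ZMod 2)[X]) :=
    s ∘ₗ ((X : (ZMod 2)[X]) ^ m • L).codRestrict _ hm
  have key : ∀ y, (X : (ZMod 2)[X]) ^ m • (y - φ (π y) • x) = d (h y) + h (d y) := by
    intro y
    have h1 : d (h y) = (X : (ZMod 2)[X]) ^ m • L y := ds _
    have h2 : h (d y) = (X : (ZMod 2)[X]) ^ m • s (d.rangeRestrict y) := by
      rw [← map_smul]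
      refine congrArg s (Subtype.ext ?_)
      change (X : (ZMod 2)[X]) ^ m • L (d y) = (X : (ZMod 2)[X]) ^ m • d y
      rw [L_apply, φ_d, zero_smul, sub_zero, π_cycle ⟨d y, dd y⟩]
    rw [h1, h2, L_apply, π_apply]
    module
  let ε : ι → (ZMod 2)[X] := fun i => φ (π (Pi.single i 1))
  have hε : ∀ y, y ⬝ᵥ ε = φ (π y) := by
    intro y
    conv_rhs => rw [pi_eq_sum_univ' y]
    simp only [map_sum, map_smul, smul_eq_mul, dotProduct]
    rfl
  refine ⟨ε, hx.cycle, ?_, ?_, LinearMap.toMatrixRight' h, m, ?_⟩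
  · ext1 i
    rw [← single_one_dotProduct i (M *ᵥ ε), dotProduct_mulVec, hε]
    exact φ_d _
  · rw [hε, φ_x]
  · refine ext_of_single_vecMul fun i => ?_
    have hh : ∀ y, y ᵥ* LinearMap.toMatrixRight' h = h y := fun y => by
      rw [← Matrix.toLinearMapRight'_apply]
      exact LinearMap.congr_fun (LinearMap.toMatrixRight'.symm_apply_apply h) y
    rw [vecMul_add, ← vecMul_vecMul, ← vecMul_vecMul, hh, hh, vecMul_smul, vecMul_sub, vecMul_one,
      vecMul_vecMulVec, hε]
    exact key _

theorem IsTower.exists_graded_splitting {M : Matrix ι ι (ZMod 2)[X]} {g : ι → ℤ × ℤ}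
    (hg : IsGraded M g) (hsq : M * M = 0) (hgr : TowersInDegreeZero M g)
    {x : ι → (ZMod 2)[X]} (hx : IsTower M x) :
    ∃ ε, IsSplitting M x ε ∧ ∀ i, ε i ≠ 0 → (g i).1 = 0 := by
  classical
  obtain ⟨ε, hε⟩ := hx.exists_splitting hg hsq
  let δ : ι → (ZMod 2)[X] := fun i => if (g i).1 = 0 then 0 else ε i
  have hδM : M *ᵥ δ = 0 := by
    ext1 i
    by_cases hi : (g i).1 = 1
    · refine Finset.sum_eq_zero fun j _ => ?_
      change M i j * δ j = 0
      rcases hg i j with h | ⟨a, -, h1, -⟩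
      · rw [h, zero_mul]
      · simp [δ, h1, hi]
    · rw [← hε.cocycle]
      refine Finset.sum_congr rfl fun j _ => ?_
      change M i j * δ j = M i j * ε j
      rcases hg i j with h | ⟨a, -, h1, -⟩
      · rw [h, zero_mul, zero_mul]
      · simp only [δ]
        rw [if_neg (by omega)]
  let w : ℤ × ℤ → ι → (ZMod 2)[X] := fun p =>
    part (fun i c => (g i).1 = p.1 ∧ (g i).2 - 2 * c = p.2) x
  have hw : ∀ p, IsBihomog g (w p) p.1 p.2 := by
    intro p i c hc
    by_contra hS
    exact hc (by rw [coeff_part, if_neg hS])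
  have hwM : ∀ p, w p ᵥ* M = 0 := by
    intro p
    rw [← part_vecMul (S' := fun i c => (g i).1 = p.1 - 1 ∧ (g i).2 - 2 * c = p.2 - 1), hx.cycle]
    · ext i c
      rw [coeff_part]
      simp
    · intro i j
      refine (hg i j).imp id fun ⟨a, ha, h1, h2⟩ => ⟨a, ha, fun c => ?_⟩
      push_cast
      omega
  have hwδ : ∀ p, w p ⬝ᵥ δ = 0 := by
    intro p
    by_cases hp : p.1 = 0
    · refine Finset.sum_eq_zero fun i _ => ?_
      by_cases hi : (g i).1 = 0
      · simp [δ, hi]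
      · have : w p i = 0 := by
          ext c
          by_contra hc
          exact hi ((hw p i c hc).1.trans hp)
        rw [this, zero_mul]
    · have h1 : w p ⬝ᵥ δ = w p ⬝ᵥ ε := by
        refine Finset.sum_congr rfl fun i _ => ?_
        by_cases hi : (g i).1 = 0
        · have : w p i = 0 := by
            ext c
            by_contra hc
            exact hp ((hw p i c hc).1.symm.trans hi)
          rw [this, zero_mul, zero_mul]
        · simp only [δ]
          rw [if_neg hi]
      have h2 : ∃ k : ℕ, ∃ y, y ᵥ* M = (X : (ZMod 2)[X]) ^ k • w p := by
        by_contra hne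
        exact hp (hgr _ _ _ (hw p) (hwM p) (not_exists.1 hne))
      obtain ⟨k, y, hy⟩ := h2
      have h3 := hε.dot_boundary y
      rw [hy, smul_dotProduct, smul_eq_mul] at h3
      rw [h1]
      exact cancel_X_pow (m := k) (by rw [h3, mul_zero])
  have hxw : x = ∑ p ∈ Finset.univ.biUnion fun i =>
      (x i).support.image fun c : ℕ => ((g i).1, (g i).2 - 2 * (c : ℤ)), w p := by
    ext i c
    simp only [Finset.sum_apply, finsetSum_coeff, w, coeff_part]
    have : ∀ p : ℤ × ℤ, ((g i).1 = p.1 ∧ (g i).2 - 2 * (c : ℤ) = p.2) ↔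
        ((g i).1, (g i).2 - 2 * (c : ℤ)) = p := fun p => by rw [Prod.ext_iff]
    simp only [this, Finset.sum_ite_eq]
    split_ifs with h
    · rfl
    · by_contra hc
      exact h (Finset.mem_biUnion.2 ⟨i, Finset.mem_univ i,
        Finset.mem_image.2 ⟨c, mem_support_iff.2 hc, rfl⟩⟩)
  have hxδ : x ⬝ᵥ δ = 0 := by
    rw [hxw, sum_dotProduct]
    exact Finset.sum_eq_zero fun p _ => hwδ p
  refine ⟨ε - δ, ⟨hx.cycle, ?_, ?_, ?_⟩, ?_⟩
  · rw [mulVec_sub, hε.cocycle, hδM, sub_zero]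
  · rw [dotProduct_sub, hε.pairing, hxδ, sub_zero]
  · obtain ⟨h, m, hm⟩ := hε.homotopy
    have e1 : (vecMulVec δ x) * M = 0 := by rw [vecMulVec_mul, hx.cycle, vecMulVec_zero]
    have e2 : M * vecMulVec δ x = 0 := by rw [mul_vecMulVec, hδM, zero_vecMulVec]
    have e3 : vecMulVec ε x * vecMulVec δ x = 0 := by
      rw [vecMulVec_mul_vecMulVec, hxδ, zero_smul, vecMulVec_zero]
    refine ⟨h + h * vecMulVec δ x, m, ?_⟩
    have e4 : (X : (ZMod 2)[X]) ^ m • vecMulVec δ x = M * h * vecMulVec δ x := by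
      have := congrArg (· * vecMulVec δ x) hm
      simp only [smul_mul_assoc, sub_mul, one_mul, e3, sub_zero, add_mul, mul_assoc h, e2, mul_zero,
        zero_add] at this
      exact this
    rw [sub_vecMulVec, add_mul, mul_add, mul_assoc h _ M, e1, mul_zero, add_zero, ← mul_assoc, ← e4,
      ← sub_add, smul_add, hm, add_assoc]
  · intro i hi
    by_contra hne
    exact hi (by simp [δ, hne])

lemma IsSplitting.towersInDegreeZero {M : Matrix ι ι (ZMod 2)[X]} {g : ι → ℤ × ℤ}
    {x ε : ι → (ZMod 2)[X]} (hs : IsSplitting M x ε) (hε : ∀ i, ε i ≠ 0 → (g i).1 = 0) :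
    TowersInDegreeZero M g := by
  intro w p q hw hc hnt
  obtain ⟨h, m, hm⟩ := hs.cycle_homotopy
  have hne : w ⬝ᵥ ε ≠ 0 := fun h0 => hnt m ⟨w ᵥ* h, by
    rw [hm w hc, h0, zero_smul, sub_zero]⟩
  obtain ⟨i, -, hi⟩ := Finset.exists_ne_zero_of_sum_ne_zero hne
  obtain ⟨c, hwc⟩ : ∃ c, (w i).coeff c ≠ 0 := by
    by_contra! h0
    exact left_ne_zero_of_mul hi (by ext c; simpa using h0 c)
  rw [← (hw i c hwc).1, hε i (right_ne_zero_of_mul hi)]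

end Graded

/-! ### Reduction to `𝔽₂[X]`: killing one variable of `𝔽₂[U,V]/(UV)` -/

section Side

instance : CharP RUV 2 := by
  have : Uv ^ 0 ≠ (0 : RUV) := by
    intro h
    have h1 : (1 : PolyUV) ∈ IUV := Ideal.Quotient.eq_zero_iff_mem.1 h
    rw [IUV, Ideal.mem_span_singleton] at h1
    obtain ⟨p, hp⟩ := h1
    simpa using congrArg MvPolynomial.constantCoeff hp
  have : Nontrivial RUV := ⟨1, 0, this⟩
  exact charP_of_injective_algebraMap (algebraMap (ZMod 2) RUV).injective 2

lemma Uv_mul_Vv : Uv * Vv = 0 :=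
  Ideal.Quotient.eq_zero_iff_mem.2 (Ideal.subset_span rfl)

/-- The ring homomorphism `R → 𝔽₂[X]` sending the `k`-th variable to `X` and the other one
to `0`. -/
noncomputable def proj (k : Fin 2) : RUV →+* (ZMod 2)[X] :=
  Ideal.Quotient.lift IUV
    (MvPolynomial.aeval fun j => if j = k then (X : (ZMod 2)[X]) else 0).toRingHom (by
      intro a ha
      rw [IUV, Ideal.mem_span_singleton] at ha
      obtain ⟨b, rfl⟩ := ha
      fin_cases k <;> simp)

lemma proj_mk_X (k j : Fin 2) :
    proj k (Ideal.Quotient.mk IUV (MvPolynomial.X j)) = if j = k then X else 0 := by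
  simp [proj]

lemma exists_eq_aeval_proj_add {k l : Fin 2} (hkl : l ≠ k) (r : RUV) :
    ∃ r', r = aeval (Ideal.Quotient.mk IUV (MvPolynomial.X k) : RUV) (proj k r) +
      Ideal.Quotient.mk IUV (MvPolynomial.X l) * r' := by
  obtain ⟨p, rfl⟩ := Ideal.Quotient.mk_surjective r
  induction p using MvPolynomial.induction_on with
  | C a =>
    refine ⟨0, ?_⟩
    have : proj k (Ideal.Quotient.mk IUV (MvPolynomial.C a)) = C a := by
      simp [proj]
    rw [this, aeval_C, mul_zero, add_zero]
    rfl
  | add p q hp hq =>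
    obtain ⟨a, ha⟩ := hp
    obtain ⟨b, hb⟩ := hq
    refine ⟨a + b, ?_⟩
    rw [map_add, map_add, map_add]
    linear_combination ha + hb
  | mul_X p j hp =>
    obtain ⟨a, ha⟩ := hp
    rw [map_mul, map_mul, map_mul, proj_mk_X]
    by_cases hj : j = k
    · subst hj
      rw [if_pos rfl, aeval_X]
      exact ⟨a * Ideal.Quotient.mk IUV (MvPolynomial.X j), by
        linear_combination (Ideal.Quotient.mk IUV (MvPolynomial.X j) : RUV) * ha⟩
    · have : j = l := by omega
      subst this
      rw [if_neg hj, map_zero, mul_zero]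
      exact ⟨Ideal.Quotient.mk IUV p, by rw [zero_add, mul_comm]⟩

lemma isHomog_one : IsHomog 1 0 0 := Or.inr (Or.inl ⟨0, by simp⟩)

lemma isHomog_zero (p q : ℤ) : IsHomog 0 p q := Or.inl rfl

lemma isHomog_mul {r r' : RUV} {p q p' q' : ℤ} (h : IsHomog r p q) (h' : IsHomog r' p' q') :
    IsHomog (r * r') (p + p') (q + q') := by
  have mixed : ∀ a b : ℕ, Uv ^ a * Vv ^ b = 0 ∨ a = 0 ∨ b = 0 := by
    intro a b
    rcases a with _ | a
    · simp
    rcases b with _ | b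
    · simp
    left
    linear_combination Uv ^ a * Vv ^ b * Uv_mul_Vv
  rcases h with rfl | ⟨a, rfl, rfl, rfl⟩ | ⟨a, rfl, rfl, rfl⟩
  · exact Or.inl (zero_mul _)
  · rcases h' with rfl | ⟨b, rfl, rfl, rfl⟩ | ⟨b, rfl, rfl, rfl⟩
    · exact Or.inl (mul_zero _)
    · exact Or.inr (Or.inl ⟨a + b, (pow_add _ _ _).symm, by push_cast; ring, by ring⟩)
    · rcases mixed a b with h0 | rfl | rfl
      · exact Or.inl h0
      · exact Or.inr (Or.inr ⟨b, by simp⟩)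
      · exact Or.inr (Or.inl ⟨a, by simp⟩)
  · rcases h' with rfl | ⟨b, rfl, rfl, rfl⟩ | ⟨b, rfl, rfl, rfl⟩
    · exact Or.inl (mul_zero _)
    · rw [mul_comm]
      rcases mixed b a with h0 | rfl | rfl
      · exact Or.inl h0
      · exact Or.inr (Or.inr ⟨a, by simp⟩)
      · exact Or.inr (Or.inl ⟨b, by simp⟩)
    · exact Or.inr (Or.inr ⟨a + b, (pow_add _ _ _).symm, by ring, by push_cast; ring⟩)

/-- One of the two quotients of `R` by a variable `s`, with `t` the surviving variable and
`g` the ordering of the two gradings for which `t` has degree `(0, -2)`. -/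
structure Side where
  s : RUV
  t : RUV
  ρ : RUV →+* (ZMod 2)[X]
  g : ℤ × ℤ ≃+ ℤ × ℤ
  map_t : ρ t = X
  ker : ∀ r, ρ r = 0 ↔ ∃ r', s * r' = r
  g_neg_one : g (-1, -1) = (-1, -1)
  map_homog : ∀ r p q, IsHomog r p q → ρ r = 0 ∨ ∃ b : ℕ, ρ r = X ^ b ∧ g (p, q) = (0, -(2 * (b : ℤ)))
  homog_pow : ∀ (b : ℕ) p q, g (p, q) = (0, -(2 * (b : ℤ))) → IsHomog (t ^ b) p q

lemma proj_eq_zero_iff {k l : Fin 2} (hkl : l ≠ k) (r : RUV) :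
    proj k r = 0 ↔ ∃ r', Ideal.Quotient.mk IUV (MvPolynomial.X l) * r' = r := by
  constructor
  · intro h
    obtain ⟨r', hr'⟩ := exists_eq_aeval_proj_add hkl r
    rw [h, map_zero, zero_add] at hr'
    exact ⟨r', hr'.symm⟩
  · rintro ⟨r', rfl⟩
    rw [map_mul, proj_mk_X, if_neg hkl, zero_mul]

/-- The quotient by `U`. -/
noncomputable def sideV : Side where
  s := Uv
  t := Vv
  ρ := proj 1
  g := AddEquiv.refl _
  map_t := proj_mk_X 1 1
  ker := proj_eq_zero_iff (by decide)
  g_neg_one := rfl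
  map_homog := by
    have hU : proj 1 Uv = 0 := proj_mk_X 1 0
    have hV : proj 1 Vv = X := proj_mk_X 1 1
    rintro r p q (rfl | ⟨a, rfl, rfl, rfl⟩ | ⟨b, rfl, rfl, rfl⟩)
    · simp
    · rcases a with _ | a
      · exact Or.inr ⟨0, by simp⟩
      · simp [hU]
    · exact Or.inr ⟨b, by simp [hV]⟩
  homog_pow := fun b p q h => Or.inr (Or.inr ⟨b, rfl, Prod.ext_iff.1 h⟩)

/-- The quotient by `V`. -/
noncomputable def sideU : Side where
  s := Vv
  t := Uv
  ρ := proj 0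
  g := AddEquiv.prodComm
  map_t := proj_mk_X 0 0
  ker := proj_eq_zero_iff (by decide)
  g_neg_one := rfl
  map_homog := by
    have hU : proj 0 Uv = X := proj_mk_X 0 0
    have hV : proj 0 Vv = 0 := proj_mk_X 0 1
    rintro r p q (rfl | ⟨a, rfl, rfl, rfl⟩ | ⟨b, rfl, rfl, rfl⟩)
    · simp
    · exact Or.inr ⟨a, by simp [hU]⟩
    · rcases b with _ | b
      · exact Or.inr ⟨0, by simp⟩
      · simp [hV]
  homog_pow := fun b p q h => Or.inr (Or.inl ⟨b, rfl, (Prod.ext_iff.1 h).symm⟩)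

/-- The matrix of the differential. -/
def dmat (C : PreCx) : Matrix (Fin C.n) (Fin C.n) RUV := Matrix.of C.dm

lemma coe_dmap (C : PreCx) (x : Msub C) : ⇑(dmap C x) = ⇑x ᵥ* dmat C := by
  ext1 j
  rw [dmap, Finsupp.linearCombination_apply, Finsupp.sum_fintype _ _ (by simp)]
  simp [Finsupp.finsetSum_apply, vecMul, dotProduct, dmat, Finsupp.single_apply]

lemma dmap_dmap_eq_zero_iff (C : PreCx) :
    (∀ x, dmap C (dmap C x) = 0) ↔ dmat C * dmat C = 0 := by
  have h : ∀ x, ⇑(dmap C (dmap C x)) = ⇑x ᵥ* (dmat C * dmat C) := fun x => by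
    rw [coe_dmap, coe_dmap, vecMul_vecMul]
  constructor
  · intro hd
    refine ext_of_single_vecMul fun i => ?_
    have := h (Finsupp.single i 1)
    rw [hd, Finsupp.single_eq_pi_single] at this
    rw [← this, vecMul_zero]
    rfl
  · intro hd x
    refine DFunLike.coe_injective ?_
    rw [h, hd, vecMul_zero]
    rfl

namespace Side

variable (S : Side)

lemma surjective : Function.Surjective S.ρ := by
  intro p
  refine ⟨aeval S.t p, ?_⟩
  have := hom_eval₂ p (algebraMap (ZMod 2) RUV) S.ρ S.t
  rw [← aeval_def, S.map_t, Subsingleton.elim (S.ρ.comp (algebraMap (ZMod 2) RUV)) C,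
    eval₂_C_X] at this
  exact this

/-- The differential after killing `s`. -/
noncomputable def redMat (C : PreCx) : Matrix (Fin C.n) (Fin C.n) (ZMod 2)[X] :=
  (dmat C).map S.ρ

/-- A chain after killing `s`. -/
noncomputable def redVec {C : PreCx} (x : Msub C) : Fin C.n → (ZMod 2)[X] := S.ρ ∘ x

lemma redVec_surjective (C : PreCx) : Function.Surjective (S.redVec (C := C)) := by
  intro w
  refine ⟨Finsupp.equivFunOnFinite.symm fun i => (S.surjective (w i)).choose, ?_⟩
  ext1 i
  exact (S.surjective (w i)).choose_spec

lemma redVec_sub {C : PreCx} (x y : Msub C) :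
    S.redVec (x - y) = S.redVec x - S.redVec y := by
  ext1 i
  simp [redVec]

lemma redVec_smul {C : PreCx} (r : RUV) (x : Msub C) :
    S.redVec (r • x) = S.ρ r • S.redVec x := by
  ext1 i
  simp [redVec]

lemma redVec_dmap {C : PreCx} (x : Msub C) :
    S.redVec (dmap C x) = S.redVec x ᵥ* S.redMat C := by
  ext1 j
  rw [redVec, Function.comp_apply, coe_dmap, RingHom.map_vecMul]
  rfl

lemma mem_range_smul_iff {C : PreCx} (x : Msub C) :
    x ∈ LinearMap.range (LinearMap.lsmul RUV (Msub C) S.s) ↔ S.redVec x = 0 := by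
  constructor
  · rintro ⟨y, rfl⟩
    rw [LinearMap.lsmul_apply, redVec_smul, (S.ker S.s).2 ⟨1, mul_one _⟩, zero_smul]
  · intro h
    choose y hy using fun i => (S.ker (x i)).1 (congrFun h i)
    refine ⟨Finsupp.equivFunOnFinite.symm y, ?_⟩
    ext1 i
    exact hy i

lemma mem_boundaries_iff {C : PreCx} (x : Msub C) :
    x ∈ LinearMap.range (LinearMap.lsmul RUV (Msub C) S.s) ⊔ LinearMap.range (dmap C) ↔
      ∃ y, y ᵥ* S.redMat C = S.redVec x := by
  rw [Submodule.mem_sup]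
  constructor
  · rintro ⟨a, ha, _, ⟨y, rfl⟩, rfl⟩
    refine ⟨S.redVec y, ?_⟩
    rw [← redVec_dmap, ← sub_eq_zero, ← redVec_sub, sub_add_cancel_right,
      ← S.mem_range_smul_iff]
    exact neg_mem ha
  · rintro ⟨w, hw⟩
    obtain ⟨y, rfl⟩ := S.redVec_surjective C w
    refine ⟨x - dmap C y, ?_, dmap C y, ⟨y, rfl⟩, sub_add_cancel _ _⟩
    rw [S.mem_range_smul_iff, redVec_sub, redVec_dmap, hw, sub_self]

/-- `x` generates the tower of the homology of `C/s`. -/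
def IsTowerGen (C : PreCx) (x : Msub C) : Prop :=
  dmap C x ∈ LinearMap.range (LinearMap.lsmul RUV (Msub C) S.s) ∧
    (∀ k : ℕ, S.t ^ k • x ∉
      LinearMap.range (LinearMap.lsmul RUV (Msub C) S.s) ⊔ LinearMap.range (dmap C)) ∧
    ∀ z : Msub C, dmap C z ∈ LinearMap.range (LinearMap.lsmul RUV (Msub C) S.s) →
      ∃ (r : RUV) (k : ℕ), S.t ^ k • (z - r • x) ∈
        LinearMap.range (LinearMap.lsmul RUV (Msub C) S.s) ⊔ LinearMap.range (dmap C)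

lemma isTowerGen_iff (C : PreCx) (x : Msub C) :
    S.IsTowerGen C x ↔ IsTower (S.redMat C) (S.redVec x) := by
  simp only [IsTowerGen, mem_range_smul_iff, mem_boundaries_iff, redVec_dmap, redVec_smul,
    redVec_sub, map_pow, S.map_t]
  constructor
  · rintro ⟨h1, h2, h3⟩
    refine ⟨h1, h2, fun w hw => ?_⟩
    obtain ⟨z, rfl⟩ := S.redVec_surjective C w
    obtain ⟨r, k, h⟩ := h3 z hw
    exact ⟨S.ρ r, k, h⟩
  · rintro ⟨h1, h2, h3⟩
    refine ⟨h1, h2, fun z hz => ?_⟩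
    obtain ⟨r, k, h⟩ := h3 _ hz
    obtain ⟨r, rfl⟩ := S.surjective r
    exact ⟨r, k, h⟩

/-- The bigrading of the generators of `C`, in the order prescribed by `S`. -/
def grading (C : PreCx) (i : Fin C.n) : ℤ × ℤ := S.g (C.gr i)

lemma isGraded {C : PreCx} (h : ∀ i j, IsHomog (C.dm i j)
    ((C.gr i).1 - 1 - (C.gr j).1) ((C.gr i).2 - 1 - (C.gr j).2)) :
    IsGraded (S.redMat C) (S.grading C) := by
  intro i j
  refine (S.map_homog _ _ _ (h i j)).imp id fun ⟨a, ha, hg⟩ => ⟨a, ha, ?_⟩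
  have : (((C.gr i).1 - 1 - (C.gr j).1, (C.gr i).2 - 1 - (C.gr j).2) : ℤ × ℤ) =
      C.gr i + (-1, -1) - C.gr j := by
    ext <;> simp [sub_eq_add_neg]
  rw [this, map_sub, map_add, S.g_neg_one, Prod.ext_iff] at hg
  simp only [Prod.fst_sub, Prod.snd_sub, Prod.fst_add, Prod.snd_add] at hg
  simp only [grading]
  omega

lemma eq_zero_or_eq_X_pow {w : (ZMod 2)[X]} (h : ∀ c c', w.coeff c ≠ 0 → w.coeff c' ≠ 0 → c = c') :
    w = 0 ∨ ∃ c, w = X ^ c ∧ w.coeff c ≠ 0 := by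
  by_cases hw : w = 0
  · exact Or.inl hw
  · have hd : w.coeff w.natDegree ≠ 0 := by simpa using hw
    refine Or.inr ⟨w.natDegree, ?_, hd⟩
    ext c
    rw [coeff_X_pow]
    split_ifs with hc
    · subst hc
      revert hd
      generalize w.coeff w.natDegree = a
      revert a
      decide
    · by_contra hne
      exact hc (h _ _ hne hd)

lemma towersInDegreeZero_iff (C : PreCx) :
    (∀ x p q, ChainHomog C x p q →
      dmap C x ∈ LinearMap.range (LinearMap.lsmul RUV (Msub C) S.s) →
      (∀ k : ℕ, S.t ^ k • x ∉
        LinearMap.range (LinearMap.lsmul RUV (Msub C) S.s) ⊔ LinearMap.range (dmap C)) →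
      (S.g (p, q)).1 = 0) ↔ TowersInDegreeZero (S.redMat C) (S.grading C) := by
  simp only [mem_range_smul_iff, mem_boundaries_iff, redVec_dmap, redVec_smul, map_pow, S.map_t]
  constructor
  · intro h w p q hw hc hn
    have : ∀ i, ∃ r, S.ρ r = w i ∧ IsHomog r ((S.g.symm (p, q)).1 - (C.gr i).1)
        ((S.g.symm (p, q)).2 - (C.gr i).2) := by
      intro i
      rcases eq_zero_or_eq_X_pow (w := w i) (fun c c' h1 h2 => by
        have := (hw i c h1).2
        have := (hw i c' h2).2
        omega) with h0 | ⟨c, h1, h2⟩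
      · exact ⟨0, by simp [h0], isHomog_zero _ _⟩
      · refine ⟨S.t ^ c, by rw [map_pow, S.map_t, h1], S.homog_pow _ _ _ ?_⟩
        have h3 := hw i c h2
        rw [← Prod.fst_sub, ← Prod.snd_sub, Prod.mk.eta, map_sub, AddEquiv.apply_symm_apply]
        simp only [grading] at h3
        ext
        · simp only [Prod.fst_sub]
          omega
        · simp only [Prod.snd_sub]
          omega
    choose x hx using this
    have hxw : S.redVec (C := C) (Finsupp.equivFunOnFinite.symm x) = w := funext fun i => (hx i).1
    have := h (Finsupp.equivFunOnFinite.symm x) (S.g.symm (p, q)).1 (S.g.symm (p, q)).2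
      (fun i => (hx i).2) (by rwa [hxw]) (by rwa [hxw])
    rwa [Prod.mk.eta, AddEquiv.apply_symm_apply] at this
  · intro h x p q hx hc hn
    refine h _ _ (S.g (p, q)).2 (fun i c hi => ?_) hc hn
    rcases S.map_homog _ _ _ (hx i) with h0 | ⟨b, hb, hg⟩
    · exact absurd (by simp [redVec, h0]) hi
    · have hcb : c = b := by
        by_contra hne
        exact hi (by simp [redVec, hb, coeff_X_pow, hne])
      have : ((p - (C.gr i).1, q - (C.gr i).2) : ℤ × ℤ) = (p, q) - C.gr i := rfl
      rw [this, map_sub, Prod.ext_iff] at hg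
      simp only [Prod.fst_sub, Prod.snd_sub] at hg
      simp only [grading]
      omega

/-- The homology of `C/s` splits off a tower compatibly with the first grading. -/
def HasGradedSplitting (C : PreCx) : Prop :=
  ∃ x ε, IsSplitting (S.redMat C) x ε ∧ ∀ i, ε i ≠ 0 → (S.grading C i).1 = 0

lemma hasGradedSplitting_of_tower {C : PreCx} (hd : dmat C * dmat C = 0)
    (hh : ∀ i j, IsHomog (C.dm i j)
      ((C.gr i).1 - 1 - (C.gr j).1) ((C.gr i).2 - 1 - (C.gr j).2))
    (hx : ∃ x, S.IsTowerGen C x) (hg : TowersInDegreeZero (S.redMat C) (S.grading C)) :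
    S.HasGradedSplitting C := by
  obtain ⟨x, hx⟩ := hx
  have hsq : S.redMat C * S.redMat C = 0 := by
    rw [redMat, ← Matrix.map_mul, hd, Matrix.map_zero _ (map_zero _)]
  obtain ⟨ε, h1, h2⟩ := ((S.isTowerGen_iff C x).1 hx).exists_graded_splitting (S.isGraded hh) hsq hg
  exact ⟨_, ε, h1, h2⟩

lemma HasGradedSplitting.exists_towerGen {S : Side} {C : PreCx} (h : S.HasGradedSplitting C) :
    ∃ x, S.IsTowerGen C x := by
  obtain ⟨w, ε, hs, -⟩ := h
  obtain ⟨x, rfl⟩ := S.redVec_surjective C w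
  refine ⟨x, (S.isTowerGen_iff C x).2 ((hs.isTower_iff _).2 ⟨hs.cycle, ?_⟩)⟩
  rw [hs.pairing]
  exact isUnit_one

lemma HasGradedSplitting.towersInDegreeZero {S : Side} {C : PreCx}
    (h : S.HasGradedSplitting C) : TowersInDegreeZero (S.redMat C) (S.grading C) := by
  obtain ⟨w, ε, hs, hε⟩ := h
  exact hs.towersInDegreeZero hε

end Side

lemma isKnotLike_iff (C : PreCx) :
    IsKnotLike C ↔ dmat C * dmat C = 0 ∧
      (∀ i j, IsHomog (C.dm i j)
        ((C.gr i).1 - 1 - (C.gr j).1) ((C.gr i).2 - 1 - (C.gr j).2)) ∧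
      sideV.HasGradedSplitting C ∧ sideU.HasGradedSplitting C := by
  constructor
  · intro h
    have hd := (dmap_dmap_eq_zero_iff C).1 h.dsq
    exact ⟨hd, h.dhomog,
      sideV.hasGradedSplitting_of_tower hd h.dhomog h.vTowerExists
        ((sideV.towersInDegreeZero_iff C).1 h.vTowerGr),
      sideU.hasGradedSplitting_of_tower hd h.dhomog h.uTowerExists
        ((sideU.towersInDegreeZero_iff C).1 h.uTowerGr)⟩
  · rintro ⟨hd, hh, hV, hU⟩
    exact ⟨(dmap_dmap_eq_zero_iff C).2 hd, hh, hV.exists_towerGen,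
      (sideV.towersInDegreeZero_iff C).2 hV.towersInDegreeZero, hU.exists_towerGen,
      (sideU.towersInDegreeZero_iff C).2 hU.towersInDegreeZero⟩

end Side

/-! ### Local maps as matrices -/

section Local

lemma IsSplitting.dotProduct_vecMul_chain {ι κ : Type*} [Fintype ι] [Fintype κ] [DecidableEq ι]
    [DecidableEq κ] {M : Matrix ι ι (ZMod 2)[X]} {N : Matrix κ κ (ZMod 2)[X]}
    {x ε : ι → (ZMod 2)[X]} {y δ : κ → (ZMod 2)[X]}
    (hM : IsSplitting M x ε) (hN : IsSplitting N y δ) {F : Matrix ι κ (ZMod 2)[X]}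
    (hF : M * F = F * N) {z : ι → (ZMod 2)[X]} (hz : z ᵥ* M = 0) :
    (z ᵥ* F) ⬝ᵥ δ = (z ⬝ᵥ ε) * ((x ᵥ* F) ⬝ᵥ δ) := by
  obtain ⟨h, m, hm⟩ := hM.cycle_homotopy
  have h1 := hN.dot_boundary ((z ᵥ* h) ᵥ* F)
  rw [vecMul_vecMul, ← hF, ← vecMul_vecMul, hm z hz, smul_vecMul, sub_vecMul, smul_vecMul,
    smul_dotProduct, sub_dotProduct, smul_dotProduct, smul_eq_mul, smul_eq_mul] at h1
  exact sub_eq_zero.1 (cancel_X_pow (m := m) (by rw [h1, mul_zero]))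

/-- The module map with matrix `F`. -/
noncomputable def mapOfMatrix {C₁ C₂ : PreCx} (F : Matrix (Fin C₁.n) (Fin C₂.n) RUV) :
    Msub C₁ →ₗ[RUV] Msub C₂ :=
  Finsupp.linearCombination RUV fun i => Finsupp.equivFunOnFinite.symm (F i)

lemma coe_mapOfMatrix {C₁ C₂ : PreCx} (F : Matrix (Fin C₁.n) (Fin C₂.n) RUV) (x : Msub C₁) :
    ⇑(mapOfMatrix F x) = ⇑x ᵥ* F := by
  ext1 j
  rw [mapOfMatrix, Finsupp.linearCombination_apply, Finsupp.sum_fintype _ _ (by simp)]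
  simp [Finsupp.finsetSum_apply, vecMul, dotProduct]

lemma exists_mapOfMatrix_eq {C₁ C₂ : PreCx} (f : Msub C₁ →ₗ[RUV] Msub C₂) :
    ∃ F, mapOfMatrix F = f := by
  refine ⟨Matrix.of fun i => ⇑(f (Finsupp.single i 1)), ?_⟩
  refine Finsupp.lhom_ext fun i r => DFunLike.coe_injective ?_
  rw [← mul_one r, ← smul_eq_mul, ← Finsupp.smul_single, map_smul, map_smul, Finsupp.coe_smul,
    Finsupp.coe_smul, coe_mapOfMatrix, Finsupp.single_eq_pi_single, single_one_vecMul]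
  rfl

lemma mapOfMatrix_single {C₁ C₂ : PreCx} (F : Matrix (Fin C₁.n) (Fin C₂.n) RUV)
    (i : Fin C₁.n) (j : Fin C₂.n) : mapOfMatrix F (Finsupp.single i 1) j = F i j := by
  rw [coe_mapOfMatrix, Finsupp.single_eq_pi_single, single_one_vecMul]
  rfl

lemma chain_iff {C₁ C₂ : PreCx} (F : Matrix (Fin C₁.n) (Fin C₂.n) RUV) :
    (∀ x, mapOfMatrix F (dmap C₁ x) = dmap C₂ (mapOfMatrix F x)) ↔
      dmat C₁ * F = F * dmat C₂ := by
  have h : ∀ x, mapOfMatrix F (dmap C₁ x) = dmap C₂ (mapOfMatrix F x) ↔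
      ⇑x ᵥ* (dmat C₁ * F) = ⇑x ᵥ* (F * dmat C₂) := fun x => by
    rw [← DFunLike.coe_fn_eq, coe_mapOfMatrix, coe_dmap, coe_dmap, coe_mapOfMatrix,
      vecMul_vecMul, vecMul_vecMul]
  simp only [h]
  refine ⟨fun hF => ext_of_single_vecMul fun i => ?_, fun hF x => by rw [hF]⟩
  rw [← Finsupp.single_eq_pi_single]
  exact hF _

lemma Side.redVec_mapOfMatrix (S : Side) {C₁ C₂ : PreCx} (F : Matrix (Fin C₁.n) (Fin C₂.n) RUV)
    (x : Msub C₁) : S.redVec (mapOfMatrix F x) = S.redVec x ᵥ* F.map S.ρ := by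
  ext1 j
  rw [redVec, Function.comp_apply, coe_mapOfMatrix, RingHom.map_vecMul]
  rfl

/-- `F` is the matrix of a local map, the condition on towers being expressed through a cycle
of `C₁` and a cocycle of `C₂`. -/
structure IsLocalMatrix {C₁ C₂ : PreCx} (x : Fin C₁.n → (ZMod 2)[X]) (ε : Fin C₂.n → (ZMod 2)[X])
    (F : Matrix (Fin C₁.n) (Fin C₂.n) RUV) : Prop where
  chain : dmat C₁ * F = F * dmat C₂
  graded : ∃ s : ℤ, ∀ i j, IsHomog (F i j) ((C₁.gr i).1 + 0 - (C₂.gr j).1)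
    ((C₁.gr i).2 + s - (C₂.gr j).2)
  isUnit : IsUnit ((x ᵥ* F.map sideV.ρ) ⬝ᵥ ε)

lemma localLE_iff {C₁ C₂ : PreCx} {x ε : Fin C₁.n → (ZMod 2)[X]} {y δ : Fin C₂.n → (ZMod 2)[X]}
    (h₁ : IsSplitting (sideV.redMat C₁) x ε) (h₂ : IsSplitting (sideV.redMat C₂) y δ) :
    LocalLE C₁ C₂ ↔ ∃ F : Matrix (Fin C₁.n) (Fin C₂.n) RUV, IsLocalMatrix x δ F := by
  have hV : ∀ C x, IsVTowerGen C x ↔ IsTower (sideV.redMat C) (sideV.redVec x) :=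
    sideV.isTowerGen_iff
  constructor
  · rintro ⟨f, hf⟩
    obtain ⟨F, rfl⟩ := exists_mapOfMatrix_eq f
    obtain ⟨s, hs⟩ := hf.graded
    refine ⟨F, (chain_iff F).1 hf.chain, ⟨s, fun i j => ?_⟩, ?_⟩
    · have := hs i j
      rwa [mapOfMatrix_single] at this
    · obtain ⟨x, rfl⟩ := sideV.redVec_surjective C₁ x
      have := hf.towers x ((hV _ _).2 ((h₁.isTower_iff _).2
        ⟨h₁.cycle, by rw [h₁.pairing]; exact isUnit_one⟩))
      rw [hV, h₂.isTower_iff, Side.redVec_mapOfMatrix] at this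
      exact this.2
  · rintro ⟨F, hc, ⟨s, hs⟩, hu⟩
    have hF : sideV.redMat C₁ * F.map sideV.ρ = F.map sideV.ρ * sideV.redMat C₂ := by
      simp only [Side.redMat, ← Matrix.map_mul, hc]
    refine ⟨mapOfMatrix F, (chain_iff F).2 hc, ⟨s, fun i j => ?_⟩, fun z hz => ?_⟩
    · rw [mapOfMatrix_single]
      exact hs i j
    · rw [hV, h₁.isTower_iff] at hz
      rw [hV, h₂.isTower_iff, Side.redVec_mapOfMatrix]
      refine ⟨?_, ?_⟩
      · rw [vecMul_vecMul, ← hF, ← vecMul_vecMul, hz.1, zero_vecMul]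
      · rw [h₁.dotProduct_vecMul_chain h₂ hF hz.1]
        exact hz.2.mul hu

end Local

/-! ### Tensor products, duals and isomorphisms -/

section TensorProduct

lemma tensorMat_map {ι κ R R' : Type*} [DecidableEq ι] [DecidableEq κ] [CommRing R] [CommRing R']
    (M : Matrix ι ι R) (N : Matrix κ κ R) (ρ : R →+* R') :
    (tensorMat M N).map ρ = tensorMat (M.map ρ) (N.map ρ) := by
  ext1 p q
  simp [tensorMat, one_apply, apply_ite ρ]

lemma tensorMat_mul_kronecker {ι κ ι' κ' R : Type*} [Fintype ι] [Fintype κ] [Fintype ι']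
    [Fintype κ'] [DecidableEq ι] [DecidableEq κ] [DecidableEq ι'] [DecidableEq κ'] [CommRing R]
    {M : Matrix ι ι R} {N : Matrix κ κ R} {M' : Matrix ι' ι' R} {N' : Matrix κ' κ' R}
    {F : Matrix ι ι' R} {G : Matrix κ κ' R} (hF : M * F = F * M') (hG : N * G = G * N') :
    tensorMat M N * kroneckerMap (· * ·) F G = kroneckerMap (· * ·) F G * tensorMat M' N' := by
  simp only [tensorMat, Matrix.add_mul, Matrix.mul_add, ← mul_kronecker_mul, hF, hG,
    Matrix.one_mul, Matrix.mul_one]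

/-- The pairs of indices of the generators of a tensor product. -/
def tensorIdx (C₁ C₂ : PreCx) : Fin (tensorCx C₁ C₂).n ≃ Fin C₁.n × Fin C₂.n :=
  finProdFinEquiv.symm

lemma tensorCx_gr (C₁ C₂ : PreCx) (p : Fin (tensorCx C₁ C₂).n) :
    (tensorCx C₁ C₂).gr p = C₁.gr (tensorIdx C₁ C₂ p).1 + C₂.gr (tensorIdx C₁ C₂ p).2 := rfl

lemma tensorCx_dm (C₁ C₂ : PreCx) (p q : Fin (tensorCx C₁ C₂).n) :
    (tensorCx C₁ C₂).dm p q =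
      (if (tensorIdx C₁ C₂ p).2 = (tensorIdx C₁ C₂ q).2 then
        C₁.dm (tensorIdx C₁ C₂ p).1 (tensorIdx C₁ C₂ q).1 else 0) +
      (if (tensorIdx C₁ C₂ p).1 = (tensorIdx C₁ C₂ q).1 then
        C₂.dm (tensorIdx C₁ C₂ p).2 (tensorIdx C₁ C₂ q).2 else 0) := rfl

lemma dmat_tensorCx (C₁ C₂ : PreCx) :
    dmat (tensorCx C₁ C₂) =
      (tensorMat (dmat C₁) (dmat C₂)).submatrix (tensorIdx C₁ C₂) (tensorIdx C₁ C₂) := by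
  ext1 p q
  simp [dmat, tensorCx_dm, tensorMat, one_apply]

lemma splitting_tensorCx {S : Side} {C₁ C₂ : PreCx} {x ε : Fin C₁.n → (ZMod 2)[X]}
    {y δ : Fin C₂.n → (ZMod 2)[X]}
    (h₁ : IsSplitting (S.redMat C₁) x ε) (h₂ : IsSplitting (S.redMat C₂) y δ) :
    IsSplitting (S.redMat (tensorCx C₁ C₂)) (tensorVec x y ∘ tensorIdx C₁ C₂)
      (tensorVec ε δ ∘ tensorIdx C₁ C₂) := by
  rw [Side.redMat, dmat_tensorCx, ← submatrix_map, tensorMat_map]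
  exact (h₁.tensor h₂).submatrix _

lemma Side.HasGradedSplitting.tensor {S : Side} {C₁ C₂ : PreCx} (h₁ : S.HasGradedSplitting C₁)
    (h₂ : S.HasGradedSplitting C₂) : S.HasGradedSplitting (tensorCx C₁ C₂) := by
  obtain ⟨x, ε, hs, hε⟩ := h₁
  obtain ⟨y, δ, ht, hδ⟩ := h₂
  refine ⟨_, _, splitting_tensorCx hs ht, fun p hp => ?_⟩
  have h1 := hε _ (left_ne_zero_of_mul hp)
  have h2 := hδ _ (right_ne_zero_of_mul hp)
  simp only [Side.grading] at h1 h2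
  rw [Side.grading, tensorCx_gr, map_add, Prod.fst_add, h1, h2, add_zero]

lemma eq_zero_of_isHomog_odd {r : RUV} {p q : ℤ} (h : IsHomog r p q) (hp : Odd p) : r = 0 := by
  obtain ⟨k, hk⟩ := hp
  rcases h with h | ⟨a, -, h, -⟩ | ⟨b, -, h, -⟩
  · exact h
  · omega
  · omega

theorem isKnotLike_tensorCx {C₁ C₂ : PreCx} (h₁ : IsKnotLike C₁) (h₂ : IsKnotLike C₂) :
    IsKnotLike (tensorCx C₁ C₂) := by
  rw [isKnotLike_iff] at h₁ h₂ ⊢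
  obtain ⟨d₁, g₁, hV₁, hU₁⟩ := h₁
  obtain ⟨d₂, g₂, hV₂, hU₂⟩ := h₂
  refine ⟨?_, fun p q => ?_, hV₁.tensor hV₂, hU₁.tensor hU₂⟩
  · rw [dmat_tensorCx, submatrix_mul_equiv, tensorMat_mul_self d₁ d₂, submatrix_zero]
    rfl
  · rw [tensorCx_dm, tensorCx_gr, tensorCx_gr]
    obtain ⟨i, j⟩ := tensorIdx C₁ C₂ p
    obtain ⟨i', j'⟩ := tensorIdx C₁ C₂ q
    have h₁ := g₁ i i'
    have h₂ := g₂ j j'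
    simp only [Prod.fst_add, Prod.snd_add]
    by_cases hi : i = i' <;> by_cases hj : j = j'
    · subst hi hj
      rw [eq_zero_of_isHomog_odd h₁ ⟨-1, by ring⟩, eq_zero_of_isHomog_odd h₂ ⟨-1, by ring⟩]
      simpa using isHomog_zero _ _
    · subst hi
      rw [if_neg hj, if_pos rfl, zero_add]
      convert h₂ using 1 <;> ring
    · subst hj
      rw [if_neg hi, if_pos rfl, add_zero]
      convert h₁ using 1 <;> ring
    · rw [if_neg hi, if_neg hj, add_zero]
      exact isHomog_zero _ _

lemma exists_splitting {C : PreCx} (h : IsKnotLike C) :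
    ∃ x ε, IsSplitting (sideV.redMat C) x ε := by
  obtain ⟨x, ε, hs, -⟩ := ((isKnotLike_iff C).1 h).2.2.1
  exact ⟨x, ε, hs⟩

theorem LocalLE.tensor {C₁ C₁' C₂ C₂' : PreCx} (k₁ : IsKnotLike C₁) (k₁' : IsKnotLike C₁')
    (k₂ : IsKnotLike C₂) (k₂' : IsKnotLike C₂') (h₁ : LocalLE C₁ C₁') (h₂ : LocalLE C₂ C₂') :
    LocalLE (tensorCx C₁ C₂) (tensorCx C₁' C₂') := by
  obtain ⟨x₁, ε₁, s₁⟩ := exists_splitting k₁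
  obtain ⟨x₁', ε₁', s₁'⟩ := exists_splitting k₁'
  obtain ⟨x₂, ε₂, s₂⟩ := exists_splitting k₂
  obtain ⟨x₂', ε₂', s₂'⟩ := exists_splitting k₂'
  obtain ⟨F, hF, ⟨s, hs⟩, uF⟩ := (localLE_iff s₁ s₁').1 h₁
  obtain ⟨G, hG, ⟨t, ht⟩, uG⟩ := (localLE_iff s₂ s₂').1 h₂
  rw [localLE_iff (splitting_tensorCx s₁ s₂) (splitting_tensorCx s₁' s₂')]
  refine ⟨(kroneckerMap (· * ·) F G).submatrix (tensorIdx C₁ C₂) (tensorIdx C₁' C₂'),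
    ?_, ⟨s + t, fun p q => ?_⟩, ?_⟩
  · rw [dmat_tensorCx, dmat_tensorCx, submatrix_mul_equiv, submatrix_mul_equiv,
      tensorMat_mul_kronecker hF hG]
  · rw [tensorCx_gr, tensorCx_gr, submatrix_apply, kroneckerMap_apply, Prod.fst_add,
      Prod.snd_add, Prod.fst_add, Prod.snd_add]
    convert isHomog_mul (hs (tensorIdx C₁ C₂ p).1 (tensorIdx C₁' C₂' q).1)
      (ht (tensorIdx C₁ C₂ p).2 (tensorIdx C₁' C₂' q).2) using 1 <;> ring
  · have : (kroneckerMap (· * ·) F G).map sideV.ρ =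
        kroneckerMap (· * ·) (F.map sideV.ρ) (G.map sideV.ρ) := by
      ext1 p q
      simp
    rw [← submatrix_map, this, submatrix_vecMul_equiv, Function.comp_assoc,
      Equiv.self_comp_symm, Function.comp_id, comp_equiv_dotProduct_comp_equiv,
      tensorVec_vecMul, tensorVec_dotProduct]
    exact uF.mul uG

lemma localLE_of_equiv {C₁ C₂ : PreCx} (e : Fin C₁.n ≃ Fin C₂.n)
    (hgr : ∀ i, C₂.gr (e i) = C₁.gr i) (hdm : ∀ i j, C₂.dm (e i) (e j) = C₁.dm i j)
    {x ε : Fin C₂.n → (ZMod 2)[X]} (hs : IsSplitting (sideV.redMat C₂) x ε) :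
    LocalLE C₁ C₂ := by
  have hd : dmat C₁ = (dmat C₂).submatrix e e := by
    ext1 i j
    exact (hdm i j).symm
  have hs' : IsSplitting (sideV.redMat C₁) (x ∘ e) (ε ∘ e) := by
    rw [Side.redMat, hd, ← submatrix_map]
    exact hs.submatrix e
  refine (localLE_iff hs' hs).2 ⟨(1 : Matrix (Fin C₂.n) (Fin C₂.n) RUV).submatrix e id,
    ?_, ⟨0, fun i j => ?_⟩, ?_⟩
  · rw [hd, submatrix_mul_equiv, mul_one]
    conv_rhs => rw [← submatrix_id_id (dmat C₂)]
    rw [← submatrix_mul _ _ _ _ _ Function.bijective_id, one_mul]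
  · rw [submatrix_apply, id_eq, one_apply]
    split_ifs with h
    · rw [← h, hgr]
      simpa using isHomog_one
    · exact isHomog_zero _ _
  · rw [← submatrix_map, Matrix.map_one _ (map_zero _) (map_one _), submatrix_vecMul_equiv,
      vecMul_one, Function.comp_id, Function.comp_assoc, Equiv.self_comp_symm, Function.comp_id,
      hs.pairing]
    exact isUnit_one

theorem localEquiv_of_equiv {C₁ C₂ : PreCx} (e : Fin C₁.n ≃ Fin C₂.n)
    (hgr : ∀ i, C₂.gr (e i) = C₁.gr i) (hdm : ∀ i j, C₂.dm (e i) (e j) = C₁.dm i j)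
    (h₁ : IsKnotLike C₁) (h₂ : IsKnotLike C₂) : LocalEquiv C₁ C₂ := by
  obtain ⟨x, ε, hs⟩ := exists_splitting h₁
  obtain ⟨y, δ, ht⟩ := exists_splitting h₂
  refine ⟨localLE_of_equiv e hgr hdm ht, localLE_of_equiv e.symm (fun i => ?_) (fun i j => ?_) hs⟩
  · rw [← hgr, e.apply_symm_apply]
  · rw [← hdm, e.apply_symm_apply, e.apply_symm_apply]

theorem localEquiv_tensor_assoc {C₁ C₂ C₃ : PreCx} (h₁ : IsKnotLike C₁) (h₂ : IsKnotLike C₂)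
    (h₃ : IsKnotLike C₃) :
    LocalEquiv (tensorCx (tensorCx C₁ C₂) C₃) (tensorCx C₁ (tensorCx C₂ C₃)) := by
  refine localEquiv_of_equiv ((tensorIdx _ _).trans <|
    ((tensorIdx C₁ C₂).prodCongr (Equiv.refl _)).trans <| (Equiv.prodAssoc _ _ _).trans <|
    ((Equiv.refl _).prodCongr (tensorIdx C₂ C₃).symm).trans (tensorIdx _ _).symm)
    (fun p => ?_) (fun p q => ?_) (isKnotLike_tensorCx (isKnotLike_tensorCx h₁ h₂) h₃)
    (isKnotLike_tensorCx h₁ (isKnotLike_tensorCx h₂ h₃))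
  · simp [tensorCx_gr, add_assoc]
  · simp only [tensorCx_dm, Equiv.trans_apply, Equiv.apply_symm_apply, Equiv.prodCongr_apply,
      Prod.map_fst, Prod.map_snd, Equiv.prodAssoc_apply, Equiv.refl_apply,
      EmbeddingLike.apply_eq_iff_eq]
    have h : ∀ a b, a = b ↔ (tensorIdx C₁ C₂ a).1 = (tensorIdx C₁ C₂ b).1 ∧
        (tensorIdx C₁ C₂ a).2 = (tensorIdx C₁ C₂ b).2 := fun a b => by
      rw [← Prod.ext_iff, EmbeddingLike.apply_eq_iff_eq]
    simp only [h, Prod.mk.injEq]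
    split_ifs <;> simp_all [add_assoc]

theorem localEquiv_tensor_comm {C₁ C₂ : PreCx} (h₁ : IsKnotLike C₁) (h₂ : IsKnotLike C₂) :
    LocalEquiv (tensorCx C₁ C₂) (tensorCx C₂ C₁) := by
  refine localEquiv_of_equiv ((tensorIdx _ _).trans <|
    (Equiv.prodComm _ _).trans (tensorIdx _ _).symm)
    (fun p => ?_) (fun p q => ?_) (isKnotLike_tensorCx h₁ h₂) (isKnotLike_tensorCx h₂ h₁)
  · simp [tensorCx_gr, add_comm]
  · simp [tensorCx_dm, add_comm]

instance : Unique (Fin trivCx.n) := inferInstanceAs (Unique (Fin 1))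

lemma trivCx_gr (i : Fin trivCx.n) : trivCx.gr i = 0 := by
  rw [Subsingleton.elim i default]
  rfl

lemma trivCx_dm (i j : Fin trivCx.n) : trivCx.dm i j = 0 := by
  change stdDm [] i j = 0
  simp [stdDm]

lemma dmat_trivCx : dmat trivCx = 0 := by
  ext1 i j
  exact trivCx_dm i j

lemma splitting_trivCx (S : Side) : IsSplitting (S.redMat trivCx) 1 1 := by
  rw [Side.redMat, dmat_trivCx, Matrix.map_zero _ (map_zero _)]
  refine ⟨vecMul_zero _, zero_mulVec _, ?_, 0, 0, ?_⟩
  · simp [dotProduct]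
  · ext1 i j
    simp [Subsingleton.elim i j]

lemma isKnotLike_trivCx : IsKnotLike trivCx := by
  refine (isKnotLike_iff _).2 ⟨by rw [dmat_trivCx, mul_zero], fun i j => ?_,
    ⟨1, 1, splitting_trivCx _, fun i _ => ?_⟩, ⟨1, 1, splitting_trivCx _, fun i _ => ?_⟩⟩
  · rw [trivCx_dm]
    exact isHomog_zero _ _
  all_goals
    rw [Side.grading, trivCx_gr, map_zero]
    rfl

theorem localEquiv_tensor_trivCx {C : PreCx} (h : IsKnotLike C) :
    LocalEquiv (tensorCx C trivCx) C := by
  refine localEquiv_of_equiv ((tensorIdx _ _).trans (Equiv.prodUnique _ _))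
    (fun p => ?_) (fun p q => ?_) (isKnotLike_tensorCx h isKnotLike_trivCx) h
  · simp [tensorCx_gr, trivCx_gr]
  · simp [tensorCx_dm, trivCx_dm, eq_iff_true_of_subsingleton]

/-- The evaluation pairing of a free module with its dual, on basis elements. -/
def evalVec (ι R : Type*) [DecidableEq ι] [CommRing R] : ι × ι → R :=
  fun p => (1 : Matrix ι ι R) p.1 p.2

lemma evalVec_vecMul {ι R : Type*} [Fintype ι] [DecidableEq ι] [CommRing R] [CharP R 2]
    (M : Matrix ι ι R) : evalVec ι R ᵥ* tensorMat M Mᵀ = 0 := by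
  ext1 ⟨i, j⟩
  simp [vecMul, dotProduct, evalVec, tensorMat, Fintype.sum_prod_type, one_apply, mul_add,
    Finset.sum_add_distrib, CharTwo.add_self_eq_zero]

lemma mulVec_evalVec {ι R : Type*} [Fintype ι] [DecidableEq ι] [CommRing R] [CharP R 2]
    (M : Matrix ι ι R) : tensorMat M Mᵀ *ᵥ evalVec ι R = 0 := by
  rw [← vecMul_transpose, tensorMat_transpose, evalVec_vecMul]

lemma tensorVec_dotProduct_evalVec {ι R : Type*} [Fintype ι] [DecidableEq ι] [CommRing R]
    (x ε : ι → R) : tensorVec x ε ⬝ᵥ evalVec ι R = x ⬝ᵥ ε := by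
  simp [dotProduct, tensorVec, evalVec, Fintype.sum_prod_type, one_apply]

lemma map_evalVec {ι R R' : Type*} [DecidableEq ι] [CommRing R] [CommRing R'] (ρ : R →+* R')
    (p : ι × ι) : ρ (evalVec ι R p) = evalVec ι R' p := by
  simp [evalVec, one_apply, apply_ite ρ]

lemma evalVec_swap {ι R : Type*} [DecidableEq ι] [CommRing R] (p : ι × ι) :
    evalVec ι R p.swap = evalVec ι R p := by
  simp [evalVec, one_apply, eq_comm]

lemma isHomog_evalVec (C : PreCx) (p : Fin C.n × Fin C.n) :
    IsHomog (evalVec (Fin C.n) RUV p) (C.gr p.1 - C.gr p.2).1 (C.gr p.1 - C.gr p.2).2 := by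
  rw [evalVec, one_apply]
  split_ifs with h
  · rw [h, sub_self]
    exact isHomog_one
  · exact isHomog_zero _ _

/-- The pairs of indices of the generators of the tensor product of `C` with its dual. -/
def tensorDualIdx (C : PreCx) : Fin (tensorCx C (dualCx C)).n ≃ Fin C.n × Fin C.n :=
  tensorIdx C (dualCx C)

lemma tensorCx_dualCx_gr (C : PreCx) (p : Fin (tensorCx C (dualCx C)).n) :
    (tensorCx C (dualCx C)).gr p =
      C.gr (tensorDualIdx C p).1 - C.gr (tensorDualIdx C p).2 :=
  (sub_eq_add_neg _ _).symm

lemma dmat_tensorCx_dualCx (C : PreCx) :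
    dmat (tensorCx C (dualCx C)) =
      (tensorMat (dmat C) (dmat C)ᵀ).submatrix (tensorDualIdx C) (tensorDualIdx C) :=
  dmat_tensorCx C (dualCx C)

lemma splitting_tensorCx_dualCx {S : Side} {C : PreCx} {x ε : Fin C.n → (ZMod 2)[X]}
    (h : IsSplitting (S.redMat C) x ε) :
    IsSplitting (S.redMat (tensorCx C (dualCx C))) (tensorVec x ε ∘ tensorDualIdx C)
      (tensorVec ε x ∘ tensorDualIdx C) :=
  splitting_tensorCx (C₂ := dualCx C) h h.transpose

lemma tensorDual_le_trivCx {C : PreCx} (h : IsKnotLike C) :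
    LocalLE (tensorCx C (dualCx C)) trivCx := by
  obtain ⟨x, ε, hs⟩ := exists_splitting h
  refine (localLE_iff (splitting_tensorCx_dualCx hs) (splitting_trivCx sideV)).2
    ⟨replicateCol _ (evalVec (Fin C.n) RUV ∘ tensorDualIdx C), ?_, ⟨0, fun p i => ?_⟩, ?_⟩
  · rw [dmat_trivCx, Matrix.mul_zero, dmat_tensorCx_dualCx, ← replicateCol_mulVec,
      submatrix_mulVec_equiv, Function.comp_assoc, Equiv.self_comp_symm, Function.comp_id,
      mulVec_evalVec]
    rfl
  · rw [tensorCx_dualCx_gr, trivCx_gr]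
    simpa using isHomog_evalVec C (tensorDualIdx C p)
  · have : ((tensorVec x ε ∘ tensorDualIdx C) ᵥ* (replicateCol (Fin trivCx.n)
        (evalVec (Fin C.n) RUV ∘ tensorDualIdx C)).map sideV.ρ) ⬝ᵥ 1 =
        (tensorVec x ε ∘ tensorDualIdx C) ⬝ᵥ
          (evalVec (Fin C.n) (ZMod 2)[X] ∘ tensorDualIdx C) := by
      simp [vecMul, dotProduct, map_evalVec]
    rw [this, comp_equiv_dotProduct_comp_equiv, tensorVec_dotProduct_evalVec, hs.pairing]
    exact isUnit_one

lemma trivCx_le_tensorDual {C : PreCx} (h : IsKnotLike C) :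
    LocalLE trivCx (tensorCx C (dualCx C)) := by
  obtain ⟨x, ε, hs⟩ := exists_splitting h
  refine (localLE_iff (splitting_trivCx sideV) (splitting_tensorCx_dualCx hs)).2
    ⟨replicateRow _ (evalVec (Fin C.n) RUV ∘ tensorDualIdx C), ?_, ⟨0, fun i p => ?_⟩, ?_⟩
  · rw [dmat_trivCx, Matrix.zero_mul, dmat_tensorCx_dualCx, ← replicateRow_vecMul,
      submatrix_vecMul_equiv, Function.comp_assoc, Equiv.self_comp_symm, Function.comp_id,
      evalVec_vecMul]
    rfl
  · have := isHomog_evalVec C (tensorDualIdx C p).swap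
    rw [evalVec_swap] at this
    rw [tensorCx_dualCx_gr, trivCx_gr]
    simpa using this
  · have : (1 ᵥ* (replicateRow (Fin trivCx.n)
        (evalVec (Fin C.n) RUV ∘ tensorDualIdx C)).map sideV.ρ) ⬝ᵥ
          (tensorVec ε x ∘ tensorDualIdx C) =
        (tensorVec ε x ∘ tensorDualIdx C) ⬝ᵥ
          (evalVec (Fin C.n) (ZMod 2)[X] ∘ tensorDualIdx C) := by
      simp [vecMul, dotProduct, map_evalVec, mul_comm]
    rw [this, comp_equiv_dotProduct_comp_equiv, tensorVec_dotProduct_evalVec, dotProduct_comm,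
      hs.pairing]
    exact isUnit_one

end TensorProduct

end KnotLike

/-- The set `KL` of local equivalence classes of knot-like complexes,
with the operation induced by `⊗_R`, forms an abelian group: the tensor product of two
knot-like complexes is knot-like, the operation is well defined on local equivalence
classes, associative and commutative, the class of `R` (with trivial differential) is
the identity, and the inverse of `[C]` is `[C^∨]` where `C^∨ = Hom_R(C, R)`. -/
theorem KL_is_abelian_group :
    (∀ C₁ C₂ : PreCx, IsKnotLike C₁ → IsKnotLike C₂ → IsKnotLike (tensorCx C₁ C₂)) ∧
    (∀ C₁ C₁' C₂ C₂' : PreCx, IsKnotLike C₁ → IsKnotLike C₁' → IsKnotLike C₂ →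
      IsKnotLike C₂' → LocalEquiv C₁ C₁' → LocalEquiv C₂ C₂' →
      LocalEquiv (tensorCx C₁ C₂) (tensorCx C₁' C₂')) ∧
    (∀ C₁ C₂ C₃ : PreCx, IsKnotLike C₁ → IsKnotLike C₂ → IsKnotLike C₃ →
      LocalEquiv (tensorCx (tensorCx C₁ C₂) C₃) (tensorCx C₁ (tensorCx C₂ C₃))) ∧
    (∀ C₁ C₂ : PreCx, IsKnotLike C₁ → IsKnotLike C₂ →
      LocalEquiv (tensorCx C₁ C₂) (tensorCx C₂ C₁)) ∧
    (∀ C : PreCx, IsKnotLike C → LocalEquiv (tensorCx C trivCx) C) ∧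
    (∀ C : PreCx, IsKnotLike C → LocalEquiv (tensorCx C (dualCx C)) trivCx) := by
  exact ⟨fun _ _ => KnotLike.isKnotLike_tensorCx,
    fun _ _ _ _ h₁ h₁' h₂ h₂' e₁ e₂ => ⟨KnotLike.LocalLE.tensor h₁ h₁' h₂ h₂' e₁.1 e₂.1,
      KnotLike.LocalLE.tensor h₁' h₁ h₂' h₂ e₁.2 e₂.2⟩,
    fun _ _ _ => KnotLike.localEquiv_tensor_assoc,
    fun _ _ => KnotLike.localEquiv_tensor_comm,
    fun _ => KnotLike.localEquiv_tensor_trivCx,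
    fun _ h => ⟨KnotLike.tensorDual_le_trivCx h, KnotLike.trivCx_le_tensorDual h⟩⟩
end
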